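/- Suppose X = (X_t)_{t∈[0,T]} is an ℝ^d-valued process satisfying condition (A1) for some α ∈ (0, 1/d) and θ ≥ 0. Let n ∈ ℕ and 0 ≤ η < min(1, (1−αd)/(2α)). Then there is a constant C > 0, depending only on α, d, η and the constants in (A1), such that for all times 0 < u < U ≤ T: ∫_{[u,U]^n} ∫_{(ℝ^d)^n} ( ∏_{j=1}^n ‖ξ_j‖^η ) · | E[ exp( i Σ_{j=1}^n ⟨ξ_j, X_{t_j}⟩ ) ] | dξ dt ≤ C^n n^{nα(d+η+θ)} (U − u)^{(1 − α(d+η)) n}. -/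

import Mathlib

open MeasureTheory Filter Topology Set RealInnerProductSpace

noncomputable section

abbrev Ed (d : ℕ) := EuclideanSpace ℝ (Fin d)

/-- Condition (A1) of the paper: for every m, every collection of frequencies with nonzero
coordinates, every partition `0 = t₀ < t₁ < … < t_m < T` and every choice of exponents
`k_{j,l} ∈ {0,4}`, the characteristic function of the linear combination of increments
satisfies the stated bound. -/
def CondA1 {Ω : Type*} [MeasurableSpace Ω] {d : ℕ} (P : Measure Ω)
    (X : ℝ → Ω → Ed d) (T α θ : ℝ) : Prop :=
  ∃ C : ℝ, 0 < C ∧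
    ∀ m : ℕ, 0 < m → ∀ ξ : Fin m → Ed d, (∀ j l, ξ j l ≠ 0) →
      ∀ t : Fin (m + 1) → ℝ, StrictMono t → t 0 = 0 → t (Fin.last m) < T →
        ∀ k : Fin m → Fin d → ℕ, (∀ j l, k j l = 0 ∨ k j l = 4) →
          ‖∫ ω, Complex.exp (Complex.I * Complex.ofReal
              (∑ j, ⟪ξ j, X (t j.succ) ω - X (t j.castSucc) ω⟫)) ∂P‖ ≤
            C ^ m * (m : ℝ) ^ (α * θ * (m : ℝ)) *
              ∏ j, ∏ l, (|ξ j l| ^ (k j l))⁻¹ *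
                ((t j.succ - t j.castSucc) ^ (α * (k j l : ℝ)))⁻¹

/-- Condition (A2) of the paper: moment bounds for the increments. -/
def CondA2 {Ω : Type*} [MeasurableSpace Ω] {d : ℕ} (P : Measure Ω)
    (X : ℝ → Ω → Ed d) (T α ι : ℝ) : Prop :=
  ∃ C : ℝ, 0 < C ∧
    ∀ p : ℝ, 1 ≤ p → ∀ s t : ℝ, 0 ≤ s → s ≤ t → t ≤ T →
      ∫ ω, ‖X t ω - X s ω‖ ^ p ∂P ≤ C ^ p * p ^ (p * ι) * |t - s| ^ (p * α)

/-- `L` is an occupation density (local time) of the path `u ↦ X u ω` on `[0,T]`: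
for every Borel `B ⊆ [0,T]` and Borel `A ⊆ ℝ^d`, the occupation measure
`τ(A,B) = λ(B ∩ X⁻¹(A))` equals `∫_A L(x,B) dx`. -/
def IsOccDensity {Ω : Type*} [MeasurableSpace Ω] {d : ℕ}
    (X : ℝ → Ω → Ed d) (T : ℝ) (L : Ed d → Set ℝ → Ω → ℝ) (ω : Ω) : Prop :=
  ∀ B : Set ℝ, MeasurableSet B → B ⊆ Icc 0 T →
    ∀ A : Set (Ed d), MeasurableSet A →
      volume (B ∩ {u | X u ω ∈ A}) = ENNReal.ofReal (∫ x in A, L x B ω)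

section Slice

variable {V E : Type*} [AddCommGroup V] [MeasurableSpace V] [MeasurableAdd₂ V] [MeasurableNeg V]
  [AddCommGroup E] [MeasurableSpace E] [MeasurableAdd₂ E] [MeasurableNeg E]
  {μ : Measure V} [SFinite μ] [μ.IsAddLeftInvariant]
  {ν : Measure E} [SFinite ν] [ν.IsAddLeftInvariant] [ν.IsNegInvariant]
  {s : V →+ E} {c : E →+ V} {φ : E → ENNReal}

theorem lintegral_slice (hs : Measurable s) (hc : Measurable c) (hφ : Measurable φ)
    (hsc : ∀ w, s (c w) = w) (h1 : ∫⁻ w, φ w ∂ν = 1) {F : V → ENNReal} (hF : Measurable F) :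
    ∫⁻ w, ∫⁻ y, F (y - c (s y) + c w) * φ (s y) ∂μ ∂ν = ∫⁻ x, F x ∂μ := by
  calc ∫⁻ w, ∫⁻ y, F (y - c (s y) + c w) * φ (s y) ∂μ ∂ν
      = ∫⁻ y, ∫⁻ w, F (y - c (s y) + c w) * φ (s y) ∂ν ∂μ := by
        apply lintegral_lintegral_swap
        apply Measurable.aemeasurable
        fun_prop
    _ = ∫⁻ y, ∫⁻ w, F (y + c w) * φ (s y) ∂ν ∂μ := by
        congr with y
        rw [← lintegral_add_left_eq_self _ (s y)]
        congr with w
        rw [map_add]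
        congr 2
        abel
    _ = ∫⁻ w, ∫⁻ y, F (y + c w) * φ (s y) ∂μ ∂ν := by
        apply lintegral_lintegral_swap
        apply Measurable.aemeasurable
        fun_prop
    _ = ∫⁻ w, ∫⁻ y, F y * φ (s y - w) ∂μ ∂ν := by
        congr with w
        rw [← lintegral_add_left_eq_self _ (-c w)]
        congr with y
        rw [map_add, map_neg, hsc]
        congr 2 <;> abel_nf
    _ = ∫⁻ y, ∫⁻ w, F y * φ (s y - w) ∂ν ∂μ := by
        apply lintegral_lintegral_swap
        apply Measurable.aemeasurable
        fun_prop
    _ = ∫⁻ x, F x ∂μ := by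
        congr with y
        rw [lintegral_const_mul _ (by fun_prop), lintegral_sub_left_eq_self, h1, mul_one]

theorem measurePreserving_slice (hs : Measurable s) (hc : Measurable c) (hφ : Measurable φ)
    (hsc : ∀ w, s (c w) = w) (h1 : ∫⁻ w, φ w ∂ν = 1) :
    MeasurePreserving (fun q : E × V => q.2 - c (s q.2) + c q.1)
      (ν.prod (μ.withDensity (fun y => φ (s y)))) μ := by
  have hm : Measurable (fun q : E × V => q.2 - c (s q.2) + c q.1) := by fun_prop
  refine ⟨hm, ?_⟩
  refine Measure.ext_of_lintegral _ fun F hF => ?_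
  rw [lintegral_map hF hm, lintegral_prod _ (by fun_prop),
    ← lintegral_slice (ν := ν) hs hc hφ hsc h1 hF]
  congr with w
  rw [lintegral_withDensity_eq_lintegral_mul _ (by fun_prop) (by fun_prop)]
  simp only [Pi.mul_apply, mul_comm]

variable (μ s φ) in
/-- The integral of `F` over the kernel of `s`, computed along the section `c` of `s`. -/
def kerIntegral (c : E →+ V) (F : V → ENNReal) : ENNReal := ∫⁻ x, F (x - c (s x)) * φ (s x) ∂μ

theorem kerIntegral_section_indep (hs : Measurable s) (hc : Measurable c) (hφ : Measurable φ)
    (hsc : ∀ w, s (c w) = w) (h1 : ∫⁻ w, φ w ∂ν = 1) {c' : E →+ V} (hc' : Measurable c')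
    (hsc' : ∀ w, s (c' w) = w) {F : V → ENNReal} (hF : Measurable F) :
    kerIntegral μ s φ c F = kerIntegral μ s φ c' F := by
  unfold kerIntegral
  rw [← lintegral_slice (ν := ν) hs hc' hφ hsc' h1 (by fun_prop)]
  have (w : E) : ∫⁻ y, F (y - c' (s y) + c' w - c (s (y - c' (s y) + c' w)))
        * φ (s (y - c' (s y) + c' w)) * φ (s y) ∂μ
      = φ w * ∫⁻ x, F (x - c' (s x)) * φ (s x) ∂μ := by
    rw [← lintegral_add_left_eq_self _ (c w - c' w), ← lintegral_const_mul _ (by fun_prop)]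
    congr with y
    simp only [map_add, map_sub, hsc, hsc', sub_self, zero_add]
    rw [mul_comm _ (φ w), mul_assoc]
    congr 3
    abel
  simp_rw [this]
  rw [lintegral_mul_const _ hφ, h1, one_mul]

theorem lintegral_slice_pair (hs : Measurable s) (hc : Measurable c) (hφ : Measurable φ)
    (hsc : ∀ w, s (c w) = w) (h1 : ∫⁻ w, φ w ∂ν = 1) {F : V × V → ENNReal} (hF : Measurable F) :
    ∫⁻ w, ∫⁻ y, ∫⁻ y', F (y - c (s y) + c w, y' - c (s y') + c w)
        ∂(μ.withDensity (fun y => φ (s y))) ∂(μ.withDensity (fun y => φ (s y))) ∂ν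
      = kerIntegral (μ.prod μ) (s.comp (AddMonoidHom.fst V V) - s.comp (AddMonoidHom.snd V V)) φ
          ((AddMonoidHom.inl V V).comp c) F := by
  unfold kerIntegral
  have hL (w : E) : ∫⁻ y, ∫⁻ y', F (y - c (s y) + c w, y' - c (s y') + c w)
        ∂(μ.withDensity (fun y => φ (s y))) ∂(μ.withDensity (fun y => φ (s y)))
      = ∫⁻ y, ∫⁻ y', φ (s y) * (F (y - c (s y) + c w, y' - c (s y') + c w) * φ (s y')) ∂μ ∂μ := by
    rw [lintegral_withDensity_eq_lintegral_mul _ (by fun_prop) (by fun_prop)]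
    congr with y
    rw [Pi.mul_apply, lintegral_withDensity_eq_lintegral_mul _ (by fun_prop) (by fun_prop),
      ← lintegral_const_mul _ (by fun_prop)]
    congr with y'
    rw [Pi.mul_apply, mul_comm (φ (s y'))]
  simp_rw [hL]
  calc ∫⁻ w, ∫⁻ y, ∫⁻ y', φ (s y) * (F (y - c (s y) + c w, y' - c (s y') + c w) * φ (s y')) ∂μ ∂μ ∂ν
      = ∫⁻ y, ∫⁻ w, ∫⁻ y', φ (s y) * (F (y - c (s y) + c w, y' - c (s y') + c w) * φ (s y'))
          ∂μ ∂ν ∂μ := by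
        apply lintegral_lintegral_swap
        apply Measurable.aemeasurable
        apply Measurable.lintegral_prod_right'
          (f := fun z : (E × V) × V => φ (s z.1.2) * (F (z.1.2 - c (s z.1.2) + c z.1.1,
            z.2 - c (s z.2) + c z.1.1) * φ (s z.2)))
        fun_prop
    _ = ∫⁻ y, ∫⁻ v, φ (s y) * F (y - c (s y) + c (s v), v) ∂μ ∂μ := by
        congr with y
        have := lintegral_slice (μ := μ) (ν := ν) hs hc hφ hsc h1
          (F := fun v => F (y - c (s y) + c (s v), v)) (by fun_prop)
        rw [lintegral_const_mul _ (by fun_prop), ← this, ← lintegral_const_mul _ (by fun_prop)]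
        congr with w
        rw [lintegral_const_mul _ (by fun_prop)]
        simp [hsc]
    _ = ∫⁻ v, ∫⁻ y, φ (s y) * F (y - c (s y) + c (s v), v) ∂μ ∂μ := by
        apply lintegral_lintegral_swap
        apply Measurable.aemeasurable
        fun_prop
    _ = ∫⁻ v, ∫⁻ y, F (y - c (s y - s v), v) * φ (s y - s v) ∂μ ∂μ := by
        congr with v
        conv_rhs => rw [← lintegral_add_left_eq_self _ (c (s v))]
        congr with y
        simp only [map_add, hsc, add_sub_cancel_left]
        rw [mul_comm]
        congr 3
        abel
    _ = _ := by
        have hm : Measurable fun q : V × V =>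
            F (q.1 - c (s q.1 - s q.2), q.2) * φ (s q.1 - s q.2) := by fun_prop
        rw [← lintegral_prod_symm (fun q : V × V =>
          F (q.1 - c (s q.1 - s q.2), q.2) * φ (s q.1 - s q.2)) hm.aemeasurable]
        congr with q
        simp [Prod.sub_def]

end Slice

theorem kerIntegral_map {V V' E : Type*} [AddCommGroup V] [MeasurableSpace V] [AddCommGroup V']
    [MeasurableSpace V'] [MeasurableAdd₂ V'] [MeasurableNeg V'] [AddCommGroup E]
    [MeasurableSpace E] {μ : Measure V} {μ' : Measure V'} {s : V →+ E} {s' : V' →+ E}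
    {c : E →+ V} {φ : E → ENNReal} (hs' : Measurable s')
    (hc : Measurable c) (hφ : Measurable φ) {L : V →+ V'} (hL : MeasurePreserving L μ μ')
    (hsL : ∀ v, s' (L v) = s v) {F : V' → ENNReal} (hF : Measurable F) :
    kerIntegral μ s φ c (fun v => F (L v)) = kerIntegral μ' s' φ (L.comp c) F := by
  unfold kerIntegral
  have := hL.measurable
  rw [← hL.map_eq, lintegral_map (by simp; fun_prop) this]
  simp [hsL]

theorem lintegral_cons {α : Type*} [MeasurableSpace α] (ν : Measure α) [SigmaFinite ν] {m : ℕ}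
    {F : (Fin (m + 1) → α) → ENNReal} (hF : Measurable F) :
    ∫⁻ x, F x ∂(Measure.pi fun _ => ν) =
      ∫⁻ a, ∫⁻ y : Fin m → α, F (Fin.cons a y) ∂(Measure.pi fun _ => ν) ∂ν := by
  have h := (measurePreserving_piFinSuccAbove (fun _ : Fin (m + 1) => ν) 0).symm
  rw [← h.map_eq, lintegral_map hF h.measurable, lintegral_prod _ (by fun_prop)]
  simp [MeasurableEquiv.piFinSuccAbove_symm_apply, Fin.insertNthEquiv]

theorem measurePreserving_uncurry {ι κ α : Type*} [Fintype ι] [Fintype κ] [MeasurableSpace α]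
    (ν : Measure α) [SigmaFinite ν] :
    MeasurePreserving (fun (x : ι → κ → α) (q : ι × κ) => x q.1 q.2)
      (Measure.pi fun _ => Measure.pi fun _ => ν) (Measure.pi fun _ => ν) := by
  have hm : Measurable (fun (x : ι → κ → α) (q : ι × κ) => x q.1 q.2) := by fun_prop
  refine ⟨hm, (Measure.pi_eq fun S hS => ?_).symm⟩
  rw [Measure.map_apply hm (MeasurableSet.univ_pi hS)]
  have : (fun (x : ι → κ → α) (q : ι × κ) => x q.1 q.2) ⁻¹' (univ.pi S)
      = univ.pi fun i => univ.pi fun k => S (i, k) := by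
    ext x
    simp
  rw [this, Measure.pi_pi]
  simp_rw [Measure.pi_pi]
  rw [Fintype.prod_prod_type]

theorem measurePreserving_reindex {ι κ α : Type*} [Fintype ι] [Fintype κ] [MeasurableSpace α]
    (ν : Measure α) [SigmaFinite ν] (σ : ι ≃ κ) :
    MeasurePreserving (fun (x : ι → α) (k : κ) => x (σ.symm k))
      (Measure.pi fun _ => ν) (Measure.pi fun _ => ν) := by
  have hm : Measurable (fun (x : ι → α) (k : κ) => x (σ.symm k)) := by fun_prop
  refine ⟨hm, (Measure.pi_eq fun S hS => ?_).symm⟩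
  rw [Measure.map_apply hm (MeasurableSet.univ_pi hS)]
  have : (fun (x : ι → α) (k : κ) => x (σ.symm k)) ⁻¹' (univ.pi S)
      = univ.pi fun i => S (σ i) := by
    ext x
    simp only [mem_preimage, mem_univ_pi]
    exact ⟨fun h i => by simpa using h (σ i), fun h k => by simpa using h (σ.symm k)⟩
  rw [this, Measure.pi_pi]
  exact σ.prod_comp (fun k => ν (S k))

/-- Summation of all the coordinates, as an additive map. -/
def sumHom (κ E : Type*) [Fintype κ] [AddCommGroup E] : (κ → E) →+ E :=
  ∑ k, Pi.evalAddMonoidHom (fun _ : κ => E) k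

@[simp] theorem sumHom_apply {κ E : Type*} [Fintype κ] [AddCommGroup E] (x : κ → E) :
    sumHom κ E x = ∑ k, x k := by
  simp [sumHom]

theorem measurable_sumHom {κ E : Type*} [Fintype κ] [AddCommGroup E] [MeasurableSpace E]
    [MeasurableAdd₂ E] : Measurable (sumHom κ E) := by
  have : (sumHom κ E : (κ → E) → E) = fun x => ∑ k, x k := by ext; simp
  rw [this]
  fun_prop

section ZeroSum

variable {d : ℕ} {φ : Ed d → ENNReal}

theorem kerIntegral_fin (hφ : Measurable φ) (h1 : ∫⁻ w, φ w = 1) {m : ℕ}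
    {F : (Fin (m + 1) → Ed d) → ENNReal} (hF : Measurable F) :
    kerIntegral volume (sumHom (Fin (m + 1)) (Ed d)) φ (AddMonoidHom.single (fun _ => Ed d) 0) F
      = ∫⁻ x : Fin m → Ed d, F (Fin.cons (-∑ i, x i) x) := by
  unfold kerIntegral
  have hsum : Measurable (sumHom (Fin (m + 1)) (Ed d)) := measurable_sumHom
  have hsingle : Measurable (AddMonoidHom.single (fun _ : Fin (m + 1) => Ed d) 0) :=
    measurable_update _
  rw [volume_pi, lintegral_cons volume (by fun_prop), lintegral_lintegral_swap]
  · congr with y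
    have (a : Ed d) : (Fin.cons a y : Fin (m + 1) → Ed d) - AddMonoidHom.single (fun _ => Ed d) 0
        (sumHom (Fin (m + 1)) (Ed d) (Fin.cons a y)) = Fin.cons (-∑ i, y i) y := by
      ext i : 1
      refine Fin.cases ?_ (fun j => ?_) i <;> simp [Fin.sum_univ_succ]
    simp_rw [this]
    rw [lintegral_const_mul]
    · simp only [sumHom_apply, Fin.sum_univ_succ, Fin.cons_zero, Fin.cons_succ]
      rw [lintegral_add_right_eq_self φ, h1, mul_one]
    · simp only [sumHom_apply, Fin.sum_univ_succ, Fin.cons_zero, Fin.cons_succ]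
      fun_prop
  · apply Measurable.aemeasurable
    have : Measurable fun q : Ed d × (Fin m → Ed d) => (Fin.cons q.1 q.2 : Fin (m + 1) → Ed d) := by
      rw [measurable_pi_iff]
      refine Fin.cases ?_ (fun j => ?_) <;> simp <;> fun_prop
    simp only [Function.uncurry_def]
    fun_prop

theorem kerIntegral_eq_of_equiv (hφ : Measurable φ) (h1 : ∫⁻ w, φ w = 1) {κ : Type*} [Fintype κ]
    {m : ℕ} (σ : Fin (m + 1) ≃ κ) {c : Ed d →+ (κ → Ed d)} (hc : Measurable c)
    (hsc : ∀ w, sumHom κ (Ed d) (c w) = w) {F : (κ → Ed d) → ENNReal} (hF : Measurable F) :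
    kerIntegral volume (sumHom κ (Ed d)) φ c F = ∫⁻ x : Fin m → Ed d,
      F (fun k => (Fin.cons (-∑ i, x i) x : Fin (m + 1) → Ed d) (σ.symm k)) := by
  let L : (Fin (m + 1) → Ed d) →+ (κ → Ed d) :=
    { toFun := fun x k => x (σ.symm k), map_zero' := rfl, map_add' := fun _ _ => rfl }
  have hL : MeasurePreserving L volume volume := measurePreserving_reindex volume σ
  have hsL (v : Fin (m + 1) → Ed d) :
      sumHom κ (Ed d) (L v) = sumHom (Fin (m + 1)) (Ed d) v := by
    simp only [sumHom_apply]
    exact σ.symm.sum_comp v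
  have hsingle : Measurable (AddMonoidHom.single (fun _ : Fin (m + 1) => Ed d) 0) :=
    measurable_update _
  have hm := hL.measurable
  refine Eq.trans ?_ (kerIntegral_fin hφ h1 (F := fun x => F (L x)) (by fun_prop))
  rw [kerIntegral_map measurable_sumHom hsingle hφ hL hsL hF]
  refine kerIntegral_section_indep (ν := volume) measurable_sumHom hc hφ hsc h1 ?_ ?_ hF
  · exact hm.comp hsingle
  · intro w
    rw [AddMonoidHom.comp_apply, hsL]
    simp

end ZeroSum

theorem isNegInvariant_pi_const (ι : Type*) [Fintype ι] {β : Type*} [MeasurableSpace β]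
    [AddCommGroup β] [MeasurableNeg β] (ρ : Measure β) [SigmaFinite ρ] [ρ.IsNegInvariant] :
    (Measure.pi fun _ : ι => ρ).IsNegInvariant := inferInstance

section Double

variable {d : ℕ} {φ : Ed d → ENNReal} {ι κ : Type*} [Fintype ι] [Fintype κ]

variable (ι κ) in
/-- Summation of all the entries of a matrix, as an additive map. -/
def sumHom₂ (E : Type*) [AddCommGroup E] : (ι → κ → E) →+ E :=
  (sumHom κ E).comp (sumHom ι (κ → E))

theorem sumHom₂_apply {E : Type*} [AddCommGroup E] (x : ι → κ → E) :
    sumHom₂ ι κ E x = ∑ i, ∑ k, x i k := by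
  simp only [sumHom₂, AddMonoidHom.comp_apply, sumHom_apply, Finset.sum_apply]
  exact Finset.sum_comm

theorem measurable_sumHom₂ {E : Type*} [AddCommGroup E] [MeasurableSpace E] [MeasurableAdd₂ E] :
    Measurable (sumHom₂ ι κ E) :=
  measurable_sumHom.comp measurable_sumHom

variable (ι κ d) in
/-- Lebesgue measure on matrices with entries in `Ed d`. -/
def vol₂ : Measure (ι → κ → Ed d) := Measure.pi fun _ => Measure.pi fun _ => volume

instance sigmaFinite_vol₂ : SigmaFinite (vol₂ d ι κ) := by
  have h (β : Type _) [MeasurableSpace β] (ρ : Measure β) [SigmaFinite ρ] :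
      SigmaFinite (Measure.pi fun _ : ι => ρ) := inferInstance
  exact h (κ → Ed d) (Measure.pi fun _ => volume)

instance isAddLeftInvariant_vol₂ : (vol₂ d ι κ).IsAddLeftInvariant := by
  have h (β : Type _) [MeasurableSpace β] [AddCommGroup β] [MeasurableAdd β] (ρ : Measure β)
      [SigmaFinite ρ] [ρ.IsAddLeftInvariant] :
      (Measure.pi fun _ : ι => ρ).IsAddLeftInvariant := inferInstance
  exact h (κ → Ed d) (Measure.pi fun _ => volume)

instance isNegInvariant_vol₂ : (vol₂ d ι κ).IsNegInvariant := by
  have := isNegInvariant_pi_const κ (volume : Measure (Ed d))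
  exact isNegInvariant_pi_const ι (Measure.pi fun _ : κ => (volume : Measure (Ed d)))

/-- The frequencies of `x` together with the opposite frequencies of `y`. -/
def joinNeg {E : Type*} [AddCommGroup E] (x y : ι → κ → E) (q : (ι ⊕ ι) × κ) : E :=
  Sum.elim x (-y) q.1 q.2

theorem measurePreserving_joinNeg :
    MeasurePreserving (fun z : (ι → κ → Ed d) × (ι → κ → Ed d) => joinNeg z.1 z.2)
      ((vol₂ d ι κ).prod (vol₂ d ι κ)) volume := by
  have h1 : MeasurePreserving (Prod.map id Neg.neg :
      (ι → κ → Ed d) × (ι → κ → Ed d) → (ι → κ → Ed d) × (ι → κ → Ed d))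
      ((vol₂ d ι κ).prod (vol₂ d ι κ)) ((vol₂ d ι κ).prod (vol₂ d ι κ)) :=
    (MeasurePreserving.id (vol₂ d ι κ)).prod
      (Measure.measurePreserving_neg (vol₂ d ι κ))
  have h2 := measurePreserving_sumPiEquivProdPi_symm
    (fun _ : ι ⊕ ι => (Measure.pi fun _ => volume : Measure (κ → Ed d)))
  have h3 := measurePreserving_uncurry (ι := ι ⊕ ι) (κ := κ) (volume : Measure (Ed d))
  have : (fun z : (ι → κ → Ed d) × (ι → κ → Ed d) => joinNeg z.1 z.2) =
      (fun (x : ι ⊕ ι → κ → Ed d) (q : (ι ⊕ ι) × κ) => x q.1 q.2) ∘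
        ((MeasurableEquiv.sumPiEquivProdPi (fun _ : ι ⊕ ι => κ → Ed d)).symm ∘
          Prod.map id Neg.neg) := by
    funext z q
    obtain ⟨a | a, j⟩ := q <;> rfl
  rw [this]
  exact h3.comp (h2.comp h1)

theorem lintegral_slice_pair_joinNeg (hφ : Measurable φ) (h1 : ∫⁻ w, φ w = 1)
    {c : Ed d →+ (ι → κ → Ed d)} (hc : Measurable c) (hsc : ∀ w, sumHom₂ ι κ (Ed d) (c w) = w)
    {m : ℕ} (σ : Fin (m + 1) ≃ (ι ⊕ ι) × κ) {F : ((ι ⊕ ι) × κ → Ed d) → ENNReal}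
    (hF : Measurable F) :
    ∫⁻ w, ∫⁻ y, ∫⁻ y', F (joinNeg (y - c (sumHom₂ ι κ (Ed d) y) + c w)
          (y' - c (sumHom₂ ι κ (Ed d) y') + c w))
        ∂((vol₂ d ι κ).withDensity (fun y => φ (sumHom₂ ι κ (Ed d) y)))
        ∂((vol₂ d ι κ).withDensity (fun y => φ (sumHom₂ ι κ (Ed d) y)))
      = ∫⁻ x : Fin m → Ed d,
          F (fun k => (Fin.cons (-∑ i, x i) x : Fin (m + 1) → Ed d) (σ.symm k)) := by
  let L : (ι → κ → Ed d) × (ι → κ → Ed d) →+ ((ι ⊕ ι) × κ → Ed d) :=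
    { toFun := fun z => joinNeg z.1 z.2
      map_zero' := by
        ext q : 1
        obtain ⟨a | a, j⟩ := q <;> simp [joinNeg]
      map_add' := fun z z' => by
        ext q : 1
        obtain ⟨a | a, j⟩ := q <;> simp [joinNeg, add_comm] }
  have hL : MeasurePreserving L ((vol₂ d ι κ).prod (vol₂ d ι κ)) volume := measurePreserving_joinNeg
  have hm := hL.measurable
  have hsL (z) : sumHom ((ι ⊕ ι) × κ) (Ed d) (L z) = ((sumHom₂ ι κ (Ed d)).comp
      (AddMonoidHom.fst (ι → κ → Ed d) (ι → κ → Ed d)) -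
        (sumHom₂ ι κ (Ed d)).comp (AddMonoidHom.snd (ι → κ → Ed d) (ι → κ → Ed d))) z := by
    simp only [sumHom_apply, Fintype.sum_prod_type, Fintype.sum_sum_type,
      AddMonoidHom.sub_apply, AddMonoidHom.comp_apply, sumHom₂_apply]
    simp [L, joinNeg, sub_eq_add_neg]
  have hc' : Measurable ((AddMonoidHom.inl (ι → κ → Ed d) (ι → κ → Ed d)).comp c) :=
    hc.prodMk measurable_const
  refine (lintegral_slice_pair (μ := (vol₂ d ι κ)) (F := fun z => F (L z)) measurable_sumHom₂
    hc hφ hsc h1 (by fun_prop)).trans ?_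
  rw [kerIntegral_map measurable_sumHom hc' hφ hL hsL hF,
    kerIntegral_eq_of_equiv hφ h1 σ (hm.comp hc') _ hF]
  intro w
  rw [AddMonoidHom.comp_apply, hsL]
  simp [hsc]

end Double

/-- The joint characteristic function of the process `X` at times `τ` and frequencies `ξ`. -/
def jointCharFun {Ω : Type*} [MeasurableSpace Ω] {d : ℕ} (P : Measure Ω) (X : ℝ → Ω → Ed d)
    {κ : Type*} [Fintype κ] (τ : κ → ℝ) (ξ : κ → Ed d) : ℂ :=
  ∫ ω, Complex.exp (Complex.I * Complex.ofReal (∑ k, ⟪ξ k, X (τ k) ω⟫)) ∂P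

theorem jointCharFun_comp_equiv {Ω : Type*} [MeasurableSpace Ω] {d : ℕ} (P : Measure Ω)
    (X : ℝ → Ω → Ed d) {ι κ : Type*} [Fintype ι] [Fintype κ] (σ : ι ≃ κ) (τ : κ → ℝ)
    (ξ : ι → Ed d) :
    jointCharFun P X τ (fun k => ξ (σ.symm k)) = jointCharFun P X (fun i => τ (σ i)) ξ := by
  unfold jointCharFun
  congr with ω
  rw [← σ.sum_comp]
  simp

theorem norm_cexp_I_mul_ofReal (x : ℝ) : ‖Complex.exp (Complex.I * Complex.ofReal x)‖ = 1 := by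
  rw [mul_comm, Complex.norm_exp_ofReal_mul_I]

/-- The sums `∑_{i ≥ j} x i`. -/
def tailSum {E : Type*} [AddCommGroup E] {m : ℕ} (x : Fin m → E) (j : Fin m) : E :=
  ∑ i ∈ Finset.Ici j, x i

section TailSum

variable {E : Type*} [AddCommGroup E] {m : ℕ}

theorem tailSum_cons_zero (a : E) (y : Fin m → E) :
    tailSum (Fin.cons a y : Fin (m + 1) → E) 0 = a + ∑ i, y i := by
  have : Finset.Ici (0 : Fin (m + 1)) = Finset.univ := by ext; simp
  rw [tailSum, this, Fin.sum_univ_succ]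
  simp

theorem tailSum_cons_succ (a : E) (y : Fin m → E) (j : Fin m) :
    tailSum (Fin.cons a y : Fin (m + 1) → E) j.succ = tailSum y j := by
  have : Finset.Ici j.succ = (Finset.Ici j).map (Fin.succEmb m) := by
    simp
  rw [tailSum, this, Finset.sum_map]
  simp [tailSum]

theorem measurable_tailSum [MeasurableSpace E] [MeasurableAdd₂ E] (j : Fin m) :
    Measurable fun x : Fin m → E => tailSum x j := by
  unfold tailSum
  fun_prop

end TailSum

theorem sum_inner_cons_neg_sum {E : Type*} [NormedAddCommGroup E] [InnerProductSpace ℝ E] :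
    ∀ {m : ℕ} (x : Fin m → E) (Y : Fin (m + 1) → E),
      ∑ i, ⟪(Fin.cons (-∑ i, x i) x : Fin (m + 1) → E) i, Y i⟫ =
        ∑ j : Fin m, ⟪tailSum x j, Y j.succ - Y j.castSucc⟫
  | 0, x, Y => by simp
  | m + 1, x, Y => by
    obtain ⟨a, y, rfl⟩ : ∃ a y, x = Fin.cons a y := ⟨x 0, Fin.tail x, (Fin.cons_self_tail x).symm⟩
    have ih := sum_inner_cons_neg_sum y (fun i => Y i.succ)
    rw [Fin.sum_univ_succ] at ih
    rw [Fin.sum_univ_succ, Fin.sum_univ_succ, Fin.sum_univ_succ (fun j : Fin (m + 1) =>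
      ⟪tailSum (Fin.cons a y : Fin (m + 1) → E) j, Y j.succ - Y j.castSucc⟫), tailSum_cons_zero]
    simp only [tailSum_cons_succ, Fin.cons_zero, Fin.cons_succ, ← Fin.succ_castSucc] at ih ⊢
    rw [← ih, Fin.sum_univ_succ]
    simp only [Fin.cons_zero, Fin.cons_succ, inner_neg_left, inner_add_left, inner_sub_right,
      Fin.castSucc_zero, Fin.succ_zero_eq_one]
    ring

theorem prod_weight_cons_neg_sum_le {E : Type*} [AddCommGroup E] {b : E → ℝ}
    (hb1 : ∀ x, 0 ≤ b x) (hb0 : b 0 = 1) (hbn : ∀ x, b (-x) = b x)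
    (hb : ∀ x y, b (x - y) ≤ b x * b y) :
    ∀ {m : ℕ} (x : Fin m → E), ∏ i, b ((Fin.cons (-∑ i, x i) x : Fin (m + 1) → E) i) ≤
      ∏ j, b (tailSum x j) ^ 2
  | 0, x => by simp [hb0]
  | m + 1, x => by
    obtain ⟨a, y, rfl⟩ : ∃ a y, x = Fin.cons a y := ⟨x 0, Fin.tail x, (Fin.cons_self_tail x).symm⟩
    have ih := prod_weight_cons_neg_sum_le hb1 hb0 hbn hb y
    rw [Fin.prod_univ_succ] at ih
    rw [Fin.prod_univ_succ, Fin.prod_univ_succ, Fin.prod_univ_succ (fun j : Fin (m + 1) =>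
      b (tailSum (Fin.cons a y : Fin (m + 1) → E) j) ^ 2), tailSum_cons_zero, Fin.sum_univ_succ]
    simp only [tailSum_cons_succ, Fin.cons_zero, Fin.cons_succ, hbn] at ih ⊢
    have h := hb (a + ∑ i, y i) (∑ i, y i)
    rw [add_sub_cancel_right] at h
    calc b (a + ∑ i, y i) * (b a * ∏ i, b (y i))
        ≤ b (a + ∑ i, y i) * ((b (a + ∑ i, y i) * b (∑ i, y i)) * ∏ i, b (y i)) := by
          gcongr
          · exact hb1 _
          · exact Finset.prod_nonneg fun _ _ => hb1 _
      _ = b (a + ∑ i, y i) ^ 2 * (b (∑ i, y i) * ∏ i, b (y i)) := by ring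
      _ ≤ _ := by gcongr

theorem lintegral_prod_tailSum {d : ℕ} :
    ∀ {m : ℕ} {g : Fin m → Ed d → ENNReal}, (∀ j, Measurable (g j)) →
      ∫⁻ x : Fin m → Ed d, ∏ j, g j (tailSum x j) = ∏ j, ∫⁻ v, g j v
  | 0, g, hg => by simp [volume_pi]
  | m + 1, g, hg => by
    have hm (j : Fin (m + 1)) := measurable_tailSum (E := Ed d) j
    rw [volume_pi, lintegral_cons volume (by fun_prop)]
    simp only [Fin.prod_univ_succ, tailSum_cons_zero, tailSum_cons_succ]
    rw [← lintegral_prod_tailSum (g := fun j => g j.succ) (fun j => hg _)]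
    have hm' (j : Fin m) := measurable_tailSum (E := Ed d) j
    rw [lintegral_lintegral_swap (by
      apply Measurable.aemeasurable
      simp only [Function.uncurry_def]
      fun_prop), ← lintegral_const_mul _ (by fun_prop)]
    congr with y
    rw [lintegral_mul_const _ (by fun_prop), lintegral_add_right_eq_self]

section ZeroSumBound

variable {Ω : Type*} [MeasurableSpace Ω] {d : ℕ} {P : Measure Ω} [IsProbabilityMeasure P]
  {X : ℝ → Ω → Ed d}

theorem exists_exponent_bound {α : ℝ} {x D : ℝ} (hD : 0 < D) :
    ∃ k : ℕ, (k = 0 ∨ k = 4) ∧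
      (|x| ^ k)⁻¹ * (D ^ (α * (k : ℝ)))⁻¹ = (max 1 (|x| * D ^ α) ^ 4)⁻¹ := by
  rcases le_total (|x| * D ^ α) 1 with h | h
  · exact ⟨0, Or.inl rfl, by simp [max_eq_left h]⟩
  · refine ⟨4, Or.inr rfl, ?_⟩
    rw [max_eq_right h, mul_pow, mul_inv, ← Real.rpow_natCast (D ^ α), ← Real.rpow_mul hD.le]

theorem continuousAt_integral_cexp {ψ : ℝ → Ω → ℝ} (hψm : ∀ ε, Measurable (ψ ε))
    (hψ : ∀ ω, Continuous fun ε => ψ ε ω) (ε₀ : ℝ) :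
    ContinuousAt (fun ε => ∫ ω, Complex.exp (Complex.I * Complex.ofReal (ψ ε ω)) ∂P) ε₀ := by
  apply continuousAt_of_dominated (bound := fun _ => 1)
  · refine Eventually.of_forall fun ε => Measurable.aestronglyMeasurable ?_
    have := hψm ε
    fun_prop
  · exact Eventually.of_forall fun ε => Eventually.of_forall fun ω =>
      (norm_cexp_I_mul_ofReal _).le
  · exact integrable_const _
  · refine Eventually.of_forall fun ω => Continuous.continuousAt ?_
    have := hψ ω
    fun_prop

theorem norm_jointCharFun_cons_neg_sum_le (hmeas : ∀ t, Measurable (X t)) {C T α θ : ℝ}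
    (hC : ∀ m : ℕ, 0 < m → ∀ ξ : Fin m → Ed d, (∀ j l, ξ j l ≠ 0) →
      ∀ t : Fin (m + 1) → ℝ, StrictMono t → t 0 = 0 → t (Fin.last m) < T →
        ∀ k : Fin m → Fin d → ℕ, (∀ j l, k j l = 0 ∨ k j l = 4) →
          ‖∫ ω, Complex.exp (Complex.I * Complex.ofReal
              (∑ j, ⟪ξ j, X (t j.succ) ω - X (t j.castSucc) ω⟫)) ∂P‖ ≤
            C ^ m * (m : ℝ) ^ (α * θ * (m : ℝ)) *
              ∏ j, ∏ l, (|ξ j l| ^ (k j l))⁻¹ *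
                ((t j.succ - t j.castSucc) ^ (α * (k j l : ℝ)))⁻¹)
    {m : ℕ} {τ : Fin (m + 1) → ℝ} (hτ : StrictMono τ) (hτ0 : 0 < τ 0)
    (hτT : τ (Fin.last m) < T) (x : Fin m → Ed d) :
    ‖jointCharFun P X τ (Fin.cons (-∑ i, x i) x)‖ ≤
      C ^ (m + 1) * ((m + 1 : ℕ) : ℝ) ^ (α * θ * ((m + 1 : ℕ) : ℝ)) *
        ∏ j, ∏ l, (max 1 (|tailSum x j l| * (τ j.succ - τ j.castSucc) ^ α) ^ 4)⁻¹ := by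
  let e : Ed d := WithLp.toLp 2 fun _ => 1
  let ζ : ℝ → Fin (m + 1) → Ed d := fun ε => Fin.cons (ε • e) fun j => tailSum x j + ε • e
  let t : Fin (m + 2) → ℝ := Fin.cons 0 τ
  have htm : StrictMono t := by
    rw [Fin.strictMono_iff_lt_succ]
    intro i
    refine Fin.cases ?_ (fun j => ?_) i
    · simpa [t] using hτ0
    · simpa [t, ← Fin.succ_castSucc] using hτ (Fin.castSucc_lt_succ (i := j))
  have hΔ (j : Fin m) : 0 < τ j.succ - τ j.castSucc :=
    sub_pos.2 (hτ (Fin.castSucc_lt_succ (i := j)))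
  let ψ : ℝ → Ω → ℝ := fun ε ω => ∑ j, ⟪ζ ε j, X (t j.succ) ω - X (t j.castSucc) ω⟫
  have hζ (j : Fin (m + 1)) : Continuous fun ε => ζ ε j := by
    refine Fin.cases ?_ (fun j => ?_) j
    · simp only [ζ, Fin.cons_zero]
      fun_prop
    · simp only [ζ, Fin.cons_succ]
      fun_prop
  have hlim : Tendsto (fun ε => ‖∫ ω, Complex.exp (Complex.I * Complex.ofReal (ψ ε ω)) ∂P‖)
      (𝓝[>] 0) (𝓝 ‖jointCharFun P X τ (Fin.cons (-∑ i, x i) x)‖) := by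
    have h := continuousAt_integral_cexp (P := P) (ψ := ψ) (fun ε => by fun_prop)
      (fun ω => by fun_prop) 0
    have h0 : ∫ ω, Complex.exp (Complex.I * Complex.ofReal (ψ 0 ω)) ∂P =
        jointCharFun P X τ (Fin.cons (-∑ i, x i) x) := by
      unfold jointCharFun
      congr with ω
      rw [sum_inner_cons_neg_sum x (fun i => X (τ i) ω)]
      simp [ψ, ζ, t, Fin.sum_univ_succ]
    rw [← h0]
    exact (h.tendsto.mono_left nhdsWithin_le_nhds).norm
  have hlim2 : Tendsto (fun ε => C ^ (m + 1) * ((m + 1 : ℕ) : ℝ) ^ (α * θ * ((m + 1 : ℕ) : ℝ)) *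
        ∏ j : Fin m, ∏ l, (max 1 (|ζ ε j.succ l| * (τ j.succ - τ j.castSucc) ^ α) ^ 4)⁻¹)
      (𝓝[>] 0) (𝓝 (C ^ (m + 1) * ((m + 1 : ℕ) : ℝ) ^ (α * θ * ((m + 1 : ℕ) : ℝ)) *
        ∏ j, ∏ l, (max 1 (|tailSum x j l| * (τ j.succ - τ j.castSucc) ^ α) ^ 4)⁻¹)) := by
    refine Tendsto.mono_left ?_ nhdsWithin_le_nhds
    have h0 (j : Fin m) (l : Fin d) : tailSum x j l = ζ 0 j.succ l := by simp [ζ]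
    simp_rw [h0]
    apply Continuous.tendsto
    refine continuous_const.mul (continuous_finsetProd _ fun j _ => continuous_finsetProd _
      fun l _ => Continuous.inv₀ ?_ fun ε => by positivity)
    have := hζ j.succ
    fun_prop
  refine le_of_tendsto_of_tendsto hlim hlim2 ?_
  have hne : ∀ᶠ ε in 𝓝[>] (0 : ℝ), ∀ (j : Fin m) (l : Fin d), tailSum x j l + ε ≠ 0 := by
    rw [eventually_all]
    intro j
    rw [eventually_all]
    intro l
    rcases eq_or_ne (tailSum x j l) 0 with h | h
    · filter_upwards [self_mem_nhdsWithin] with ε hε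
      rw [h, zero_add]
      exact (mem_Ioi.1 hε).ne'
    · refine nhdsWithin_le_nhds ?_
      have : ContinuousAt (fun ε : ℝ => tailSum x j l + ε) 0 := by fun_prop
      exact this.eventually_ne (by simpa using h)
  filter_upwards [hne, self_mem_nhdsWithin] with ε hε hε0
  have hε0' : 0 < ε := hε0
  choose k hk hkb using fun (j : Fin m) (l : Fin d) =>
    exists_exponent_bound (α := α) (x := ζ ε j.succ l) (hΔ j)
  have hA := hC (m + 1) m.succ_pos (ζ ε) (fun j l => by
      refine Fin.cases ?_ (fun j => ?_) j
      · simpa [ζ, e] using hε0'.ne'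
      · simpa [ζ, e] using hε j l) t htm rfl (by simpa [t, ← Fin.succ_last] using hτT)
      (Fin.cons (fun _ => 0) k) (fun j l => by
      refine Fin.cases ?_ (fun j => ?_) j
      · simp
      · simpa using hk j l)
  refine hA.trans (le_of_eq ?_)
  rw [Fin.prod_univ_succ]
  simp [t, ← hkb]

end ZeroSumBound

section Weight

variable {d : ℕ}

/-- The polynomial weight `1 + ρ ‖x‖`. -/
def weight (ρ : ℝ) (x : Ed d) : ℝ := 1 + ρ * ‖x‖

theorem one_le_weight {ρ : ℝ} (hρ : 0 ≤ ρ) (x : Ed d) : 1 ≤ weight ρ x := by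
  unfold weight
  have := mul_nonneg hρ (norm_nonneg x)
  linarith

theorem weight_pos {ρ : ℝ} (hρ : 0 ≤ ρ) (x : Ed d) : 0 < weight ρ x :=
  one_pos.trans_le (one_le_weight hρ x)

theorem continuous_weight (ρ : ℝ) : Continuous (weight ρ : Ed d → ℝ) := by
  unfold weight
  fun_prop

theorem measurable_weight (ρ : ℝ) : Measurable (weight ρ : Ed d → ℝ) :=
  (continuous_weight ρ).measurable

theorem weight_sub_le {ρ : ℝ} (hρ : 0 ≤ ρ) (x y : Ed d) :
    weight ρ (x - y) ≤ weight ρ x * weight ρ y := by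
  unfold weight
  have h1 : ρ * ‖x - y‖ ≤ ρ * (‖x‖ + ‖y‖) := by
    gcongr
    exact norm_sub_le x y
  nlinarith [mul_nonneg (mul_nonneg hρ (norm_nonneg x)) (mul_nonneg hρ (norm_nonneg y))]

theorem prod_weight_cons_neg_sum_le_tailSum {ρ : ℝ} (hρ : 0 ≤ ρ) {m : ℕ} (x : Fin m → Ed d) :
    ∏ i, weight ρ ((Fin.cons (-∑ i, x i) x : Fin (m + 1) → Ed d) i) ≤
      ∏ j, weight ρ (tailSum x j) ^ 2 :=
  prod_weight_cons_neg_sum_le (fun x => (weight_pos hρ x).le) (by simp [weight])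
    (by simp [weight]) (weight_sub_le hρ) x

theorem one_add_sum_le_prod_one_add {ι : Type*} (s : Finset ι) {f : ι → ℝ} (hf : ∀ i, 0 ≤ f i) :
    1 + ∑ i ∈ s, f i ≤ ∏ i ∈ s, (1 + f i) := by
  classical
  induction s using Finset.induction_on with
  | empty => simp
  | insert a s ha ih =>
    rw [Finset.sum_insert ha, Finset.prod_insert ha]
    nlinarith [hf a, Finset.sum_nonneg (s := s) fun i _ => hf i]

theorem one_add_norm_le_prod (z : Ed d) : 1 + ‖z‖ ≤ ∏ l, (1 + |z l|) := by
  refine le_trans ?_ (one_add_sum_le_prod_one_add Finset.univ fun l => abs_nonneg (z l))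
  gcongr
  rw [EuclideanSpace.norm_eq]
  refine Real.sqrt_le_iff.2 ⟨Finset.sum_nonneg fun _ _ => abs_nonneg _, ?_⟩
  simpa using Finset.sum_sq_le_sq_sum_of_nonneg (s := Finset.univ) (f := fun l => |z l|)
    fun l _ => abs_nonneg _

theorem one_add_sq_mul_inv_max_pow_le {t : ℝ} (ht : 0 ≤ t) :
    (1 + t) ^ 2 * (max 1 t ^ 4)⁻¹ ≤ 8 * (1 + t ^ 2)⁻¹ := by
  rw [← div_eq_mul_inv, ← div_eq_mul_inv, div_le_div_iff₀ (by positivity) (by positivity)]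
  rcases le_total t 1 with h | h
  · rw [max_eq_left h]
    nlinarith [pow_le_one₀ ht h (n := 2), mul_nonneg ht ht]
  · rw [max_eq_right h]
    have h2 : t ≤ t ^ 2 := by nlinarith
    have h3 : (1 + t) ^ 2 ≤ 4 * t ^ 2 := by nlinarith
    have h4 : 1 + t ^ 2 ≤ 2 * t ^ 2 := by nlinarith
    calc (1 + t) ^ 2 * (1 + t ^ 2) ≤ (4 * t ^ 2) * (2 * t ^ 2) := by gcongr
      _ = 8 * t ^ 4 := by ring

theorem lintegral_one_add_norm_sq_lt_top :
    ∫⁻ z : Ed d, ENNReal.ofReal ((1 + ‖z‖) ^ 2 * ∏ l, (max 1 |z l| ^ 4)⁻¹) < ⊤ := by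
  have h1 : Integrable (fun z : Fin d → ℝ => ∏ l, (8 * (1 + (z l) ^ 2)⁻¹)) := by
    refine Integrable.fintype_prod (f := fun _ t => 8 * (1 + t ^ 2)⁻¹) fun _ => ?_
    exact integrable_inv_one_add_sq.const_mul 8
  have h2 : Integrable (fun z : Ed d => ∏ l, (8 * (1 + (z l) ^ 2)⁻¹)) :=
    (PiLp.volume_preserving_ofLp (Fin d)).integrable_comp_of_integrable h1
  refine lt_of_le_of_lt (lintegral_mono fun z => ENNReal.ofReal_le_ofReal ?_)
    h2.lintegral_lt_top
  calc (1 + ‖z‖) ^ 2 * ∏ l, (max 1 |z l| ^ 4)⁻¹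
      ≤ (∏ l, (1 + |z l|)) ^ 2 * ∏ l, (max 1 |z l| ^ 4)⁻¹ := by
        gcongr
        exact one_add_norm_le_prod z
    _ = ∏ l, ((1 + |z l|) ^ 2 * (max 1 |z l| ^ 4)⁻¹) := by
        rw [Finset.prod_mul_distrib, Finset.prod_pow]
    _ ≤ ∏ l, (8 * (1 + (z l) ^ 2)⁻¹) := by
        refine Finset.prod_le_prod (fun _ _ => by positivity) fun l _ => ?_
        simpa using one_add_sq_mul_inv_max_pow_le (abs_nonneg (z l))

theorem lintegral_comp_smul_of_pos {r : ℝ} (hr : 0 < r) {G : Ed d → ENNReal} (hG : Measurable G) :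
    ∫⁻ v, G v = ENNReal.ofReal (r ^ d) * ∫⁻ z, G (r • z) := by
  have h : ∫⁻ z, G (r • z) = ∫⁻ v, G v ∂(Measure.map (r • ·) volume) :=
    (lintegral_map hG (by fun_prop)).symm
  rw [h, Measure.map_addHaar_smul _ hr.ne', lintegral_smul_measure, smul_eq_mul, ← mul_assoc,
    ← ENNReal.ofReal_mul (by positivity), finrank_euclideanSpace_fin, abs_of_pos (by positivity),
    mul_inv_cancel₀ (by positivity), ENNReal.ofReal_one, one_mul]

theorem rpow_mul_one_add_rpow_le {s a α e : ℝ} (hs : 0 < s) (ha : 0 ≤ a) (hα : 0 ≤ α)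
    (he : 0 ≤ e) (he1 : e ≤ 1) :
    s ^ (-a) * (1 + s ^ (-α)) ^ (2 * e) ≤ 4 * (s ^ (-(a + α * (2 * e))) + 1) := by
  have h4 : (2 : ℝ) ^ (2 * e) ≤ 4 := by
    calc (2 : ℝ) ^ (2 * e) ≤ 2 ^ (2 : ℝ) := by
          apply Real.rpow_le_rpow_of_exponent_le <;> linarith
      _ = 4 := by norm_num
  rcases le_total s 1 with h | h
  · have h1 : 1 ≤ s ^ (-α) := Real.one_le_rpow_of_pos_of_le_one_of_nonpos hs h (by linarith)
    calc s ^ (-a) * (1 + s ^ (-α)) ^ (2 * e) ≤ s ^ (-a) * (2 * s ^ (-α)) ^ (2 * e) := by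
          gcongr
          linarith
      _ = 2 ^ (2 * e) * s ^ (-(a + α * (2 * e))) := by
          rw [Real.mul_rpow (by norm_num) (by positivity), ← Real.rpow_mul hs.le, neg_add,
            Real.rpow_add hs]
          ring_nf
      _ ≤ 4 * s ^ (-(a + α * (2 * e))) := by gcongr
      _ ≤ _ := by linarith
  · have h1 : s ^ (-α) ≤ 1 := Real.rpow_le_one_of_one_le_of_nonpos h (by linarith)
    have h2 : s ^ (-a) ≤ 1 := Real.rpow_le_one_of_one_le_of_nonpos h (by linarith)
    have h3 : 0 < s ^ (-(a + α * (2 * e))) := by positivity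
    calc s ^ (-a) * (1 + s ^ (-α)) ^ (2 * e) ≤ 1 * 2 ^ (2 * e) := by
          gcongr
          linarith
      _ ≤ _ := by linarith

variable (d) in
/-- The value of the integral in `lintegral_one_add_norm_sq_lt_top`. -/
def decayConst : ℝ :=
  (∫⁻ z : Ed d, ENNReal.ofReal ((1 + ‖z‖) ^ 2 * ∏ l, (max 1 |z l| ^ 4)⁻¹)).toReal

theorem lintegral_weight_mul_decay_le {lam Δ α e : ℝ} (hlam : 0 < lam) (hΔ : 0 < Δ) (hα : 0 < α)
    (he : 0 ≤ e) (he1 : e ≤ 1) :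
    ∫⁻ v : Ed d, ENNReal.ofReal
        (weight (lam ^ (-α)) v ^ (2 * e) * ∏ l, (max 1 (|v l| * Δ ^ α) ^ 4)⁻¹) ≤
      ENNReal.ofReal (lam ^ (α * d) *
        (4 * decayConst d * ((lam * Δ) ^ (-(α * (d + 2 * e))) + 1))) := by
  have hr : 0 < Δ ^ (-α) := by positivity
  have hw := measurable_weight (d := d) (lam ^ (-α))
  rw [lintegral_comp_smul_of_pos hr (by fun_prop)]
  have hint : ENNReal.ofReal (decayConst d) =
      ∫⁻ z : Ed d, ENNReal.ofReal ((1 + ‖z‖) ^ 2 * ∏ l, (max 1 |z l| ^ 4)⁻¹) :=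
    ENNReal.ofReal_toReal lintegral_one_add_norm_sq_lt_top.ne
  have hs : lam ^ (-α) * Δ ^ (-α) = (lam * Δ) ^ (-α) := (Real.mul_rpow hlam.le hΔ.le).symm
  have hpt (z : Ed d) : weight (lam ^ (-α)) (Δ ^ (-α) • z) ^ (2 * e) *
        ∏ l, (max 1 (|(Δ ^ (-α) • z) l| * Δ ^ α) ^ 4)⁻¹ ≤
      (1 + (lam * Δ) ^ (-α)) ^ (2 * e) * ((1 + ‖z‖) ^ 2 * ∏ l, (max 1 |z l| ^ 4)⁻¹) := by
    have h1 (l : Fin d) : |(Δ ^ (-α) • z) l| * Δ ^ α = |z l| := by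
      rw [PiLp.smul_apply, smul_eq_mul, abs_mul, abs_of_pos hr, mul_right_comm,
        ← Real.rpow_add hΔ]
      simp
    simp_rw [h1]
    rw [← mul_assoc]
    gcongr
    have h2 : weight (lam ^ (-α)) (Δ ^ (-α) • z) ≤ (1 + (lam * Δ) ^ (-α)) * (1 + ‖z‖) := by
      have : 0 < (lam * Δ) ^ (-α) := by positivity
      rw [weight, norm_smul, Real.norm_of_nonneg hr.le, ← mul_assoc, hs]
      nlinarith [norm_nonneg z]
    have h0 := (weight_pos (d := d) (ρ := lam ^ (-α)) (by positivity) (Δ ^ (-α) • z)).le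
    calc _ ≤ ((1 + (lam * Δ) ^ (-α)) * (1 + ‖z‖)) ^ (2 * e) := by gcongr
      _ = (1 + (lam * Δ) ^ (-α)) ^ (2 * e) * (1 + ‖z‖) ^ (2 * e) :=
          Real.mul_rpow (by positivity) (by positivity)
      _ ≤ (1 + (lam * Δ) ^ (-α)) ^ (2 * e) * (1 + ‖z‖) ^ (2 : ℝ) := by
          gcongr
          · linarith [norm_nonneg z]
          · linarith
      _ = _ := by norm_num
  calc ENNReal.ofReal ((Δ ^ (-α)) ^ d) * ∫⁻ z : Ed d, ENNReal.ofReal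
          (weight (lam ^ (-α)) (Δ ^ (-α) • z) ^ (2 * e) *
            ∏ l, (max 1 (|(Δ ^ (-α) • z) l| * Δ ^ α) ^ 4)⁻¹)
      ≤ ENNReal.ofReal ((Δ ^ (-α)) ^ d) * ∫⁻ z : Ed d,
          ENNReal.ofReal ((1 + (lam * Δ) ^ (-α)) ^ (2 * e)) *
          ENNReal.ofReal ((1 + ‖z‖) ^ 2 * ∏ l, (max 1 |z l| ^ 4)⁻¹) := by
        gcongr with z
        rw [← ENNReal.ofReal_mul (by positivity)]
        exact ENNReal.ofReal_le_ofReal (hpt z)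
    _ = ENNReal.ofReal ((Δ ^ (-α)) ^ d * ((1 + (lam * Δ) ^ (-α)) ^ (2 * e) * decayConst d)) := by
        rw [lintegral_const_mul _ (by fun_prop), ← hint, ENNReal.ofReal_mul (by positivity),
          ENNReal.ofReal_mul (by positivity)]
    _ ≤ _ := by
        refine ENNReal.ofReal_le_ofReal ?_
        have hc : 0 ≤ decayConst d := ENNReal.toReal_nonneg
        have h3 := rpow_mul_one_add_rpow_le (s := lam * Δ) (a := α * d) (α := α) (e := e)
          (by positivity) (by positivity) hα.le he he1
        have h4 : (Δ ^ (-α)) ^ d = lam ^ (α * d) * (lam * Δ) ^ (-(α * d)) := by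
          rw [← Real.rpow_natCast, ← Real.rpow_mul hΔ.le, Real.mul_rpow hlam.le hΔ.le,
            ← mul_assoc, ← Real.rpow_add hlam]
          simp
        rw [h4, mul_assoc]
        refine mul_le_mul_of_nonneg_left ?_ (by positivity)
        rw [← mul_assoc]
        refine (mul_le_mul_of_nonneg_right h3 hc).trans (le_of_eq ?_)
        rw [← mul_add]
        ring

end Weight

section Combine

variable {Ω : Type*} [MeasurableSpace Ω] {P : Measure Ω} [IsProbabilityMeasure P] {d : ℕ}
  {X : ℝ → Ω → Ed d}

/-- The bound of condition (A1) for a fixed constant `C`. -/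
def IncrementBound {Ω : Type*} [MeasurableSpace Ω] {d : ℕ} (P : Measure Ω)
    (X : ℝ → Ω → Ed d) (T α θ C : ℝ) : Prop :=
  ∀ m : ℕ, 0 < m → ∀ ξ : Fin m → Ed d, (∀ j l, ξ j l ≠ 0) →
    ∀ t : Fin (m + 1) → ℝ, StrictMono t → t 0 = 0 → t (Fin.last m) < T →
      ∀ k : Fin m → Fin d → ℕ, (∀ j l, k j l = 0 ∨ k j l = 4) →
        ‖∫ ω, Complex.exp (Complex.I * Complex.ofReal
            (∑ j, ⟪ξ j, X (t j.succ) ω - X (t j.castSucc) ω⟫)) ∂P‖ ≤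
          C ^ m * (m : ℝ) ^ (α * θ * (m : ℝ)) *
            ∏ j, ∏ l, (|ξ j l| ^ (k j l))⁻¹ *
              ((t j.succ - t j.castSucc) ^ (α * (k j l : ℝ)))⁻¹

variable (d) in
/-- The contribution of a time increment of length `s` to the integrals over the frequencies. -/
def gapBound (α e s : ℝ) : ℝ := 4 * decayConst d * (s ^ (-(α * (d + 2 * e))) + 1)

theorem lintegral_prod_weight_mul_norm_jointCharFun_le (hmeas : ∀ t, Measurable (X t))
    {C T α θ lam e : ℝ} (hC0 : 0 < C) (hC : IncrementBound P X T α θ C) (hlam : 0 < lam)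
    (hα : 0 < α) (he : 0 ≤ e) (he1 : e ≤ 1)
    {m : ℕ} {τ : Fin (m + 1) → ℝ} (hτ : StrictMono τ) (hτ0 : 0 < τ 0)
    (hτT : τ (Fin.last m) < T) :
    ∫⁻ x : Fin m → Ed d, ENNReal.ofReal
        ((∏ i, weight (lam ^ (-α)) ((Fin.cons (-∑ i, x i) x : Fin (m + 1) → Ed d) i)) ^ e *
          ‖jointCharFun P X τ (Fin.cons (-∑ i, x i) x)‖) ≤
      ENNReal.ofReal (C ^ (m + 1) * ((m + 1 : ℕ) : ℝ) ^ (α * θ * ((m + 1 : ℕ) : ℝ))) *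
        ∏ j : Fin m, ENNReal.ofReal (lam ^ (α * d) *
          gapBound d α e (lam * (τ j.succ - τ j.castSucc))) := by
  have hρ : 0 ≤ lam ^ (-α) := by positivity
  have hΔ (j : Fin m) : 0 < τ j.succ - τ j.castSucc :=
    sub_pos.2 (hτ (Fin.castSucc_lt_succ (i := j)))
  have hw := measurable_weight (d := d) (lam ^ (-α))
  have hw0 := fun x => (weight_pos (d := d) hρ x).le
  let g (j : Fin m) (v : Ed d) : ℝ := weight (lam ^ (-α)) v ^ (2 * e) *
    ∏ l, (max 1 (|v l| * (τ j.succ - τ j.castSucc) ^ α) ^ 4)⁻¹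
  have hg (j v) : 0 ≤ g j v := mul_nonneg (Real.rpow_nonneg (hw0 v) _)
    (Finset.prod_nonneg fun _ _ => by positivity)
  have hK : 0 ≤ C ^ (m + 1) * ((m + 1 : ℕ) : ℝ) ^ (α * θ * ((m + 1 : ℕ) : ℝ)) := by positivity
  calc _ ≤ ∫⁻ x : Fin m → Ed d, ENNReal.ofReal
          (C ^ (m + 1) * ((m + 1 : ℕ) : ℝ) ^ (α * θ * ((m + 1 : ℕ) : ℝ))) *
          ∏ j, ENNReal.ofReal (g j (tailSum x j)) := by
        refine lintegral_mono fun x => ?_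
        rw [← ENNReal.ofReal_prod_of_nonneg fun j _ => hg j _, ← ENNReal.ofReal_mul hK]
        refine ENNReal.ofReal_le_ofReal ?_
        have h1 := norm_jointCharFun_cons_neg_sum_le hmeas hC hτ hτ0 hτT x
        have h2 : (∏ i, weight (lam ^ (-α))
            ((Fin.cons (-∑ i, x i) x : Fin (m + 1) → Ed d) i)) ^ e ≤
            ∏ j, weight (lam ^ (-α)) (tailSum x j) ^ (2 * e) := by
          calc _ ≤ (∏ j, weight (lam ^ (-α)) (tailSum x j) ^ 2) ^ e :=
                Real.rpow_le_rpow (Finset.prod_nonneg fun _ _ => hw0 _)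
                  (prod_weight_cons_neg_sum_le_tailSum hρ x) he
            _ = _ := by
              rw [← Real.finsetProd_rpow _ _ fun _ _ => sq_nonneg _]
              refine Finset.prod_congr rfl fun j _ => ?_
              rw [Real.rpow_mul (hw0 _)]
              norm_num
        calc _ ≤ _ := mul_le_mul h2 h1 (norm_nonneg _)
              (Finset.prod_nonneg fun _ _ => Real.rpow_nonneg (hw0 _) _)
          _ = _ := by
            simp only [g]
            rw [Finset.prod_mul_distrib]
            ring
    _ = ENNReal.ofReal (C ^ (m + 1) * ((m + 1 : ℕ) : ℝ) ^ (α * θ * ((m + 1 : ℕ) : ℝ))) *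
          ∏ j, ∫⁻ v, ENNReal.ofReal (g j v) := by
        have hgm (j) : Measurable fun v => ENNReal.ofReal (g j v) := by
          simp only [g]
          fun_prop
        rw [lintegral_const_mul, lintegral_prod_tailSum hgm]
        exact Finset.measurable_prod _ fun j _ => (hgm j).comp (measurable_tailSum j)
    _ ≤ _ := by
        gcongr with j
        exact lintegral_weight_mul_decay_le hlam (hΔ j) hα he he1

end Combine

section Gaps

theorem lintegral_prod_gap_le {ν : Measure ℝ} [IsProbabilityMeasure ν] {g : ℝ → ENNReal}
    (hg : Measurable g) {K : ENNReal} (hK : ∀ b, ∫⁻ a, g (b - a) ∂ν ≤ K) :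
    ∀ m : ℕ, ∫⁻ τ : Fin (m + 1) → ℝ, ∏ j : Fin m, g (τ j.succ - τ j.castSucc)
      ∂(Measure.pi fun _ => ν) ≤ K ^ m
  | 0 => by simp
  | m + 1 => by
    have hm : Measurable fun τ : Fin (m + 1 + 1) → ℝ =>
        ∏ j : Fin (m + 1), g (τ j.succ - τ j.castSucc) := by fun_prop
    rw [lintegral_cons ν hm]
    simp only [Fin.prod_univ_succ, Fin.cons_succ, Fin.castSucc_zero, Fin.cons_zero,
      ← Fin.succ_castSucc]
    rw [lintegral_lintegral_swap (by fun_prop)]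
    calc _ = ∫⁻ y : Fin (m + 1) → ℝ, (∫⁻ a, g (y 0 - a) ∂ν) *
            ∏ j : Fin m, g (y j.succ - y j.castSucc) ∂(Measure.pi fun _ => ν) := by
          refine lintegral_congr fun y => ?_
          rw [lintegral_mul_const _ (by fun_prop)]
      _ ≤ ∫⁻ y : Fin (m + 1) → ℝ, K * ∏ j : Fin m, g (y j.succ - y j.castSucc)
            ∂(Measure.pi fun _ => ν) := by
          gcongr with y
          exact hK _
      _ ≤ _ := by
          rw [lintegral_const_mul _ (by fun_prop), pow_succ']
          gcongr
          exact lintegral_prod_gap_le hg hK m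

variable {d : ℕ}

variable (d) in
/-- The bound for the contribution of a time increment, exponentially tilted and extended by zero
to nonpositive increments. -/
def tiltedGap (α e lam s : ℝ) : ENNReal :=
  (Ioi 0).indicator (fun s => ENNReal.ofReal
    (lam ^ (α * d) * (gapBound d α e (lam * s) * Real.exp (-(lam * s))))) s

theorem measurable_gapBound (α e : ℝ) : Measurable (gapBound d α e) := by
  unfold gapBound
  fun_prop

theorem measurable_tiltedGap (α e lam : ℝ) : Measurable (tiltedGap d α e lam) := by
  have := measurable_gapBound (d := d) α e
  exact Measurable.indicator (by fun_prop) measurableSet_Ioi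

theorem lintegral_gapBound_mul_exp_lt_top {α e : ℝ} (h : α * (d + 2 * e) < 1) :
    ∫⁻ s in Ioi (0 : ℝ), ENNReal.ofReal (gapBound d α e s * Real.exp (-s)) < ⊤ := by
  have h1 := Real.GammaIntegral_convergent (s := 1 - α * (d + 2 * e)) (by linarith)
  have h2 := Real.GammaIntegral_convergent (s := 1) one_pos
  have h3 : IntegrableOn (fun s => gapBound d α e s * Real.exp (-s)) (Ioi 0) := by
    refine IntegrableOn.congr_fun ((Integrable.add h1 h2).const_mul (4 * decayConst d))
      (fun s _ => ?_) measurableSet_Ioi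
    simp only [gapBound, Pi.add_apply]
    rw [show 1 - α * (d + 2 * e) - 1 = -(α * (d + 2 * e)) by ring]
    simp
    ring
  exact h3.lintegral_lt_top

variable (d) in
/-- The value of the integral in `lintegral_gapBound_mul_exp_lt_top`. -/
def gapConst (α e : ℝ) : ℝ :=
  (∫⁻ s in Ioi (0 : ℝ), ENNReal.ofReal (gapBound d α e s * Real.exp (-s))).toReal

theorem lintegral_tiltedGap {α e lam : ℝ} (h : α * (d + 2 * e) < 1) (hlam : 0 < lam) :
    ∫⁻ s, tiltedGap d α e lam s = ENNReal.ofReal (lam ^ (α * d) * lam⁻¹ * gapConst d α e) := by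
  have hm := measurable_gapBound (d := d) α e
  let G : ℝ → ENNReal := (Ioi 0).indicator fun s =>
    ENNReal.ofReal (gapBound d α e s * Real.exp (-s))
  have hG : Measurable G := Measurable.indicator (by fun_prop) measurableSet_Ioi
  have h1 (s : ℝ) : tiltedGap d α e lam s = ENNReal.ofReal (lam ^ (α * d)) * G (lam * s) := by
    by_cases hs : 0 < s
    · have : 0 < lam * s := by positivity
      simp only [tiltedGap, G]
      rw [indicator_of_mem (by exact hs), indicator_of_mem (by exact this),
        ENNReal.ofReal_mul (by positivity)]
    · have : ¬ 0 < lam * s := by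
        rw [mul_pos_iff_of_pos_left hlam]
        exact hs
      simp only [tiltedGap, G]
      rw [indicator_of_notMem (by exact hs), indicator_of_notMem (by exact this), mul_zero]
  have h2 : ∫⁻ s, G (lam * s) = ENNReal.ofReal lam⁻¹ * ∫⁻ s, G s := by
    have h : ∫⁻ z, G (lam * z) = ∫⁻ v, G v ∂(Measure.map (lam * ·) volume) :=
      (lintegral_map hG (by fun_prop)).symm
    rw [h, Real.map_volume_mul_left hlam.ne', lintegral_smul_measure, smul_eq_mul,
      abs_of_pos (by positivity)]
  simp_rw [h1]
  rw [lintegral_const_mul _ (by fun_prop), h2, lintegral_indicator measurableSet_Ioi, gapConst,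
    mul_assoc, ENNReal.ofReal_mul (by positivity), ENNReal.ofReal_mul (by positivity),
    ENNReal.ofReal_toReal (lintegral_gapBound_mul_exp_lt_top h).ne]

theorem gapConst_nonneg {α e : ℝ} : 0 ≤ gapConst d α e := ENNReal.toReal_nonneg

theorem prod_gapBound_le {α e lam u U : ℝ} (hlam : 0 < lam) {m : ℕ} {τ : Fin (m + 1) → ℝ}
    (hτ : StrictMono τ) (hu : ∀ i, τ i ∈ Icc u U) :
    ∏ j : Fin m, ENNReal.ofReal (lam ^ (α * d) *
        gapBound d α e (lam * (τ j.succ - τ j.castSucc))) ≤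
      ENNReal.ofReal (Real.exp (lam * (U - u))) *
        ∏ j : Fin m, tiltedGap d α e lam (τ j.succ - τ j.castSucc) := by
  have hΔ (j : Fin m) : 0 < τ j.succ - τ j.castSucc :=
    sub_pos.2 (hτ (Fin.castSucc_lt_succ (i := j)))
  have hsum : ∑ j : Fin m, (τ j.succ - τ j.castSucc) = τ (Fin.last m) - τ 0 := by
    have h1 := Fin.sum_univ_succ τ
    have h2 := Fin.sum_univ_castSucc τ
    rw [Finset.sum_sub_distrib]
    linarith
  have h1 (j : Fin m) : ENNReal.ofReal (lam ^ (α * d) *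
        gapBound d α e (lam * (τ j.succ - τ j.castSucc))) =
      ENNReal.ofReal (Real.exp (lam * (τ j.succ - τ j.castSucc))) *
        tiltedGap d α e lam (τ j.succ - τ j.castSucc) := by
    rw [tiltedGap, indicator_of_mem (by exact hΔ j), ← ENNReal.ofReal_mul (Real.exp_nonneg _)]
    congr 1
    rw [Real.exp_neg]
    field_simp
  simp_rw [h1]
  rw [Finset.prod_mul_distrib, ← ENNReal.ofReal_prod_of_nonneg fun _ _ => Real.exp_nonneg _,
    ← Real.exp_sum, ← Finset.mul_sum, hsum]
  gcongr
  · exact (hu _).2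
  · exact (hu _).1

/-- The uniform distribution on `[u, U]`. -/
def unif (u U : ℝ) : Measure ℝ := ENNReal.ofReal (U - u)⁻¹ • volume.restrict (Icc u U)

theorem isProbabilityMeasure_unif {u U : ℝ} (h : u < U) : IsProbabilityMeasure (unif u U) := by
  constructor
  have : 0 < U - u := sub_pos.2 h
  rw [unif, Measure.smul_apply, Measure.restrict_apply_univ, Real.volume_Icc, smul_eq_mul,
    ← ENNReal.ofReal_mul (by positivity), inv_mul_cancel₀ this.ne', ENNReal.ofReal_one]

theorem lintegral_prod_tiltedGap_le {α e lam u U : ℝ} (h : α * (d + 2 * e) < 1) (hlam : 0 < lam)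
    (hu : u < U) (m : ℕ) :
    ∫⁻ τ : Fin (m + 1) → ℝ, ∏ j : Fin m, tiltedGap d α e lam (τ j.succ - τ j.castSucc)
        ∂(Measure.pi fun _ => unif u U) ≤
      ENNReal.ofReal ((U - u)⁻¹ * (lam ^ (α * d) * lam⁻¹ * gapConst d α e)) ^ m := by
  have := isProbabilityMeasure_unif hu
  have hR : 0 < U - u := sub_pos.2 hu
  refine lintegral_prod_gap_le (measurable_tiltedGap α e lam) (fun b => ?_) m
  rw [unif, lintegral_smul_measure, smul_eq_mul, ENNReal.ofReal_mul (by positivity),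
    ← lintegral_tiltedGap h hlam,
    ← lintegral_sub_left_eq_self (tiltedGap d α e lam) b]
  gcongr
  exact Measure.restrict_le_self

end Gaps

section Sorting

variable {d m : ℕ} {κ : Type*} [Fintype κ]

theorem exists_strictMono_comp_equiv (hκ : Fintype.card κ = m + 1) {τ : κ → ℝ}
    (hτ : Function.Injective τ) : ∃ σ : Fin (m + 1) ≃ κ, StrictMono fun i => τ (σ i) := by
  let σ₀ : Fin (m + 1) ≃ κ := (Fintype.equivFinOfCardEq hκ).symm
  refine ⟨(Tuple.sort (τ ∘ σ₀)).trans σ₀, ?_⟩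
  exact (Tuple.monotone_sort (τ ∘ σ₀)).strictMono_of_injective
    ((hτ.comp σ₀.injective).comp (Tuple.sort (τ ∘ σ₀)).injective)

variable [DecidableEq κ]

variable (d m) in
/-- The sum over all the orderings of the times `τ` of the products of the tilted bounds. -/
def gapSum (α e lam : ℝ) (τ : κ → ℝ) : ENNReal :=
  ∑ σ : Fin (m + 1) ≃ κ, ∏ j : Fin m, tiltedGap d α e lam (τ (σ j.succ) - τ (σ j.castSucc))

theorem measurable_gapSum (α e lam : ℝ) : Measurable (gapSum (κ := κ) d m α e lam) := by
  have := measurable_tiltedGap (d := d) α e lam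
  unfold gapSum
  fun_prop

theorem lintegral_gapSum_le (hκ : Fintype.card κ = m + 1) {α e lam u U : ℝ}
    (h : α * (d + 2 * e) < 1) (hlam : 0 < lam) (hu : u < U) :
    ∫⁻ τ : κ → ℝ, gapSum d m α e lam τ ∂(Measure.pi fun _ => unif u U) ≤
      (m + 1).factorial *
        ENNReal.ofReal ((U - u)⁻¹ * (lam ^ (α * d) * lam⁻¹ * gapConst d α e)) ^ m := by
  have := isProbabilityMeasure_unif hu
  have hm := measurable_tiltedGap (d := d) α e lam
  unfold gapSum
  rw [lintegral_finsetSum _ fun σ _ => by fun_prop]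
  have h1 (σ : Fin (m + 1) ≃ κ) :
      ∫⁻ τ : κ → ℝ, ∏ j : Fin m, tiltedGap d α e lam (τ (σ j.succ) - τ (σ j.castSucc))
        ∂(Measure.pi fun _ => unif u U) ≤
      ENNReal.ofReal ((U - u)⁻¹ * (lam ^ (α * d) * lam⁻¹ * gapConst d α e)) ^ m := by
    have h2 := measurePreserving_reindex (unif u U) σ
    rw [← h2.map_eq, lintegral_map (by fun_prop) h2.measurable]
    simpa using lintegral_prod_tiltedGap_le h hlam hu m
  refine (Finset.sum_le_sum fun σ _ => h1 σ).trans (le_of_eq ?_)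
  rw [Finset.sum_const, Finset.card_univ, Fintype.card_equiv (Fintype.equivFinOfCardEq hκ).symm,
    Fintype.card_fin, nsmul_eq_mul]

variable {Ω : Type*} [MeasurableSpace Ω] {P : Measure Ω} [IsProbabilityMeasure P]
  {X : ℝ → Ω → Ed d}

theorem exists_equiv_lintegral_le_gapSum (hκ : Fintype.card κ = m + 1)
    (hmeas : ∀ t, Measurable (X t))
    {C T α θ lam e u U : ℝ} (hC0 : 0 < C) (hC : IncrementBound P X T α θ C) (hlam : 0 < lam)
    (hα : 0 < α) (he : 0 ≤ e) (he1 : e ≤ 1) (hu0 : 0 < u)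
    {τ : κ → ℝ} (hτ : Function.Injective τ) (hτu : ∀ k, τ k ∈ Icc u U) (hτT : ∀ k, τ k < T) :
    ∃ σ : Fin (m + 1) ≃ κ, ∫⁻ x : Fin m → Ed d,
        (fun ξ : κ → Ed d => ENNReal.ofReal
          ((∏ k, weight (lam ^ (-α)) (ξ k)) ^ e * ‖jointCharFun P X τ ξ‖))
        (fun k => (Fin.cons (-∑ i, x i) x : Fin (m + 1) → Ed d) (σ.symm k)) ≤
      ENNReal.ofReal (C ^ (m + 1) * ((m + 1 : ℕ) : ℝ) ^ (α * θ * ((m + 1 : ℕ) : ℝ))) *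
        ENNReal.ofReal (Real.exp (lam * (U - u))) * gapSum d m α e lam τ := by
  obtain ⟨σ, hσ⟩ := exists_strictMono_comp_equiv hκ hτ
  refine ⟨σ, ?_⟩
  have h1 := lintegral_prod_weight_mul_norm_jointCharFun_le hmeas hC0 hC hlam hα he he1 hσ
    (hu0.trans_le (hτu _).1) (hτT _)
  have h2 := prod_gapBound_le (d := d) (α := α) (e := e) hlam hσ fun i => hτu (σ i)
  simp only [jointCharFun_comp_equiv]
  have h3 (x : Fin (m + 1) → Ed d) : ∏ k, weight (lam ^ (-α)) (x (σ.symm k)) =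
      ∏ i, weight (lam ^ (-α)) (x i) :=
    σ.symm.prod_comp fun i => weight (lam ^ (-α)) (x i)
  simp only [h3]
  refine h1.trans ?_
  rw [mul_assoc (ENNReal.ofReal (C ^ (m + 1) * _))]
  refine mul_le_mul_right (h2.trans (mul_le_mul_right ?_ _)) _
  unfold gapSum
  exact Finset.single_le_sum (f := fun σ : Fin (m + 1) ≃ κ =>
    ∏ j : Fin m, tiltedGap d α e lam (τ (σ j.succ) - τ (σ j.castSucc)))
    (fun _ _ => zero_le) (Finset.mem_univ σ)

end Sorting

section SecondMoment

variable {Ω : Type*} [MeasurableSpace Ω] {P : Measure Ω} [IsProbabilityMeasure P]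

theorem sq_lintegral_le {E : Type*} [MeasurableSpace E] {ν : Measure E} {h : E → ENNReal}
    (hh : AEMeasurable h ν) {A : Set E} (hA : MeasurableSet A) (h0 : ∀ e ∉ A, h e = 0) :
    (∫⁻ e, h e ∂ν) ^ 2 ≤ ν A * ∫⁻ e, h e ^ 2 ∂ν := by
  have h1 := ENNReal.lintegral_mul_le_Lp_mul_Lq ν (p := 2) (q := 2)
    (by rw [Real.holderConjugate_iff]; norm_num)
    (f := A.indicator fun _ => 1) (g := h) (by fun_prop (disch := assumption)) hh
  have h2 : (A.indicator (fun _ => (1 : ENNReal)) * h) = h := by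
    funext e
    by_cases he : e ∈ A <;> simp [he, h0]
  have h3 : ∫⁻ e, A.indicator (fun _ => (1 : ENNReal)) e ^ (2 : ℝ) ∂ν = ν A := by
    rw [← lintegral_indicator_one hA]
    refine lintegral_congr fun e => ?_
    by_cases he : e ∈ A <;> simp [he]
  rw [h2, h3] at h1
  calc _ ≤ _ := pow_le_pow_left' h1 2
    _ = _ := by
      rw [mul_pow, ← ENNReal.rpow_natCast, ← ENNReal.rpow_natCast, ← ENNReal.rpow_mul,
        ← ENNReal.rpow_mul]
      norm_num

theorem lintegral_enorm_sq_eq {f : Ω → ℂ} (hf : AEStronglyMeasurable f P) {K : ℝ}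
    (hK : ∀ ω, ‖f ω‖ ≤ K) :
    ∫⁻ ω, ‖f ω‖ₑ ^ 2 ∂P = ‖∫ ω, f ω * (starRingEnd ℂ) (f ω) ∂P‖ₑ := by
  have hs : AEStronglyMeasurable (fun ω => f ω * (starRingEnd ℂ) (f ω)) P :=
    hf.mul (Complex.continuous_conj.comp_aestronglyMeasurable hf)
  have h1 : Integrable (fun ω => f ω * (starRingEnd ℂ) (f ω)) P := by
    refine Integrable.of_bound hs (K * K) (Eventually.of_forall fun ω => ?_)
    rw [norm_mul, RCLike.norm_conj]
    exact mul_self_le_mul_self (norm_nonneg _) (hK ω)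
  have h2 (ω : Ω) : f ω * (starRingEnd ℂ) (f ω) =
      Complex.ofReal ‖f ω * (starRingEnd ℂ) (f ω)‖ := by
    rw [norm_mul, RCLike.norm_conj, Complex.mul_conj, Complex.normSq_eq_norm_sq, sq]
  have h3 : ∫ ω, f ω * (starRingEnd ℂ) (f ω) ∂P =
      Complex.ofReal (∫ ω, ‖f ω * (starRingEnd ℂ) (f ω)‖ ∂P) := by
    rw [← integral_complex_ofReal]
    exact integral_congr_ae (Eventually.of_forall h2)
  rw [h3, ← ofReal_norm, Complex.norm_real, Real.norm_of_nonneg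
    (integral_nonneg fun _ => norm_nonneg _), ofReal_integral_norm_eq_lintegral_enorm h1]
  refine lintegral_congr fun ω => ?_
  rw [enorm_mul, sq]
  congr 1
  rw [← ofReal_norm, ← ofReal_norm, RCLike.norm_conj]

theorem lintegral_enorm_integral_sq_le {Y : Type*} [MeasurableSpace Y] {μ : Measure Y} [SFinite μ]
    {G : Y → Ω → ℂ} (hG : Measurable (Function.uncurry G)) {w : Y → ℝ} (hw : Integrable w μ)
    (hGw : ∀ y ω, ‖G y ω‖ ≤ w y) :
    ∫⁻ ω, ‖∫ y, G y ω ∂μ‖ₑ ^ 2 ∂P ≤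
      ∫⁻ y, ∫⁻ y', ‖∫ ω, G y ω * (starRingEnd ℂ) (G y' ω) ∂P‖ₑ ∂μ ∂μ := by
  have hG' : Measurable fun q : Y × Ω => G q.1 q.2 := hG
  have hG1 (y : Y) : Measurable fun ω => G y ω := by fun_prop
  have hm : StronglyMeasurable fun ω => ∫ y, G y ω ∂μ := by
    have : StronglyMeasurable (Function.uncurry fun (ω : Ω) (y : Y) => G y ω) :=
      (hG'.comp measurable_swap).stronglyMeasurable
    exact this.integral_prod_right
  have hK (ω : Ω) : ‖∫ y, G y ω ∂μ‖ ≤ ∫ y, w y ∂μ :=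
    norm_integral_le_of_norm_le hw (Eventually.of_forall fun y => hGw y ω)
  rw [lintegral_enorm_sq_eq hm.aestronglyMeasurable hK]
  let g : (Y × Y) × Ω → ℂ := fun q => G q.1.1 q.2 * (starRingEnd ℂ) (G q.1.2 q.2)
  have hg : Measurable g := by
    have h1 : Measurable fun q : (Y × Y) × Ω => G q.1.1 q.2 :=
      hG'.comp (by fun_prop : Measurable fun q : (Y × Y) × Ω => (q.1.1, q.2))
    have h2 : Measurable fun q : (Y × Y) × Ω => G q.1.2 q.2 :=
      hG'.comp (by fun_prop : Measurable fun q : (Y × Y) × Ω => (q.1.2, q.2))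
    exact h1.mul (Complex.continuous_conj.measurable.comp h2)
  have hgi : Integrable g ((μ.prod μ).prod P) := by
    have hww : Integrable (fun q : (Y × Y) × Ω => (w q.1.1 * w q.1.2)) ((μ.prod μ).prod P) := by
      have := (hw.mul_prod hw).mul_prod (integrable_const (μ := P) (1 : ℝ))
      simpa using this
    refine hww.mono' hg.aestronglyMeasurable (Eventually.of_forall fun q => ?_)
    rw [norm_mul, RCLike.norm_conj]
    exact mul_le_mul (hGw _ _) (hGw _ _) (norm_nonneg _) ((norm_nonneg _).trans (hGw q.1.1 q.2))
  have h1 (ω : Ω) : (∫ y, G y ω ∂μ) * (starRingEnd ℂ) (∫ y, G y ω ∂μ) =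
      ∫ z : Y × Y, g (z, ω) ∂(μ.prod μ) := by
    rw [← integral_conj, ← integral_prod_mul]
  simp_rw [h1]
  rw [integral_integral_swap (f := fun ω z => g (z, ω)) hgi.swap]
  refine (enorm_integral_le_lintegral_enorm _).trans (le_of_eq ?_)
  rw [lintegral_prod]
  refine Measurable.aemeasurable (Measurable.enorm ?_)
  exact (hg.stronglyMeasurable.integral_prod_right (ν := P)).measurable

theorem lintegral_enorm_integral_sq_le_slice {V E Y : Type*} [MeasurableSpace V]
    [MeasurableSpace E] [MeasurableSpace Y] {μ : Measure V} {ν : Measure E} [SFinite ν]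
    {μ' : Measure Y} [SFinite μ'] {Θ : E × Y → V} (hΘ : MeasurePreserving Θ (ν.prod μ') μ)
    {B : V → Ω → ℂ} (hB : Measurable (Function.uncurry B)) {w : V → ℝ} (hw : Integrable w μ)
    (hBw : ∀ x ω, ‖B x ω‖ ≤ w x) {A : Set E} (hA : MeasurableSet A)
    (hBA : ∀ e ∉ A, ∀ y ω, B (Θ (e, y)) ω = 0) :
    ∫⁻ ω, ‖∫ x, B x ω ∂μ‖ₑ ^ 2 ∂P ≤
      ν A * ∫⁻ e, ∫⁻ y, ∫⁻ y', ‖∫ ω, B (Θ (e, y)) ω * (starRingEnd ℂ) (B (Θ (e, y')) ω) ∂P‖ₑ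
        ∂μ' ∂μ' ∂ν := by
  have hB' : Measurable fun q : V × Ω => B q.1 q.2 := hB
  have hwΘ : Integrable (fun q => w (Θ q)) (ν.prod μ') := hΘ.integrable_comp_of_integrable hw
  have hBΘ : Measurable fun q : (E × Y) × Ω => B (Θ q.1) q.2 :=
    hB'.comp ((hΘ.measurable.comp measurable_fst).prodMk measurable_snd)
  let H (e : E) (ω : Ω) : ℂ := ∫ y, B (Θ (e, y)) ω ∂μ'
  have hH : Measurable (Function.uncurry H) := by
    have : Measurable fun q : (E × Ω) × Y => B (Θ (q.1.1, q.2)) q.1.2 :=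
      hBΘ.comp (by fun_prop : Measurable fun q : (E × Ω) × Y => ((q.1.1, q.2), q.1.2))
    exact (this.stronglyMeasurable.integral_prod_right (ν := μ')).measurable
  have hH' : Measurable fun q : E × Ω => H q.1 q.2 := hH
  have h1 (ω : Ω) : ‖∫ x, B x ω ∂μ‖ₑ ^ 2 ≤ ν A * ∫⁻ e, ‖H e ω‖ₑ ^ 2 ∂ν := by
    have hBω : Measurable fun x => B x ω := by fun_prop
    have hint : Integrable (fun q => B (Θ q) ω) (ν.prod μ') :=
      hwΘ.mono' (hBω.comp hΘ.measurable).aestronglyMeasurable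
        (Eventually.of_forall fun q => hBw _ _)
    have h2 : ∫ x, B x ω ∂μ = ∫ e, H e ω ∂ν := by
      rw [← hΘ.map_eq, integral_map hΘ.measurable.aemeasurable hBω.aestronglyMeasurable,
        integral_prod _ hint]
    rw [h2]
    calc _ ≤ (∫⁻ e, ‖H e ω‖ₑ ∂ν) ^ 2 := pow_le_pow_left' (enorm_integral_le_lintegral_enorm _) 2
      _ ≤ _ := by
        refine sq_lintegral_le (by fun_prop) hA fun e he => ?_
        simp [H, hBA e he]
  calc _ ≤ ∫⁻ ω, ν A * ∫⁻ e, ‖H e ω‖ₑ ^ 2 ∂ν ∂P := lintegral_mono h1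
    _ = ν A * ∫⁻ e, ∫⁻ ω, ‖H e ω‖ₑ ^ 2 ∂P ∂ν := by
      have hm : Measurable fun q : Ω × E => ‖H q.2 q.1‖ₑ ^ 2 :=
        ((hH'.comp measurable_swap).enorm).pow_const 2
      rw [lintegral_const_mul _ hm.lintegral_prod_right', lintegral_lintegral_swap hm.aemeasurable]
    _ ≤ _ := by
      refine mul_le_mul_right (lintegral_mono_ae ?_) _
      filter_upwards [hwΘ.prod_right_ae] with e he
      exact lintegral_enorm_integral_sq_le
        (hBΘ.comp (by fun_prop : Measurable fun q : Y × Ω => ((e, q.1), q.2))) he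
        fun y ω => hBw _ _

end SecondMoment

section Phase

/-- The unimodular factor turning `z` into `‖z‖`. -/
def phase (z : ℂ) : ℂ := (starRingEnd ℂ) z / Complex.ofReal ‖z‖

theorem norm_phase_le (z : ℂ) : ‖phase z‖ ≤ 1 := by
  rw [phase, norm_div, RCLike.norm_conj, Complex.norm_real, norm_norm]
  exact div_self_le_one _

theorem phase_mul_self (z : ℂ) : phase z * z = Complex.ofReal ‖z‖ := by
  rcases eq_or_ne z 0 with rfl | hz
  · simp
  · have : Complex.ofReal ‖z‖ ≠ 0 := by simpa using hz
    rw [phase, div_mul_eq_mul_div, mul_comm, Complex.mul_conj, Complex.normSq_eq_norm_sq,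
      div_eq_iff this]
    push_cast
    ring

theorem measurable_phase : Measurable phase := by
  have := Complex.continuous_conj.measurable
  unfold phase
  fun_prop

theorem pow_lintegral_le_lintegral_pow {α : Type*} [MeasurableSpace α] {π : Measure α}
    [IsProbabilityMeasure π] {h : α → ENNReal} (hh : AEMeasurable h π) {N : ℕ} (hN : 1 ≤ N) :
    (∫⁻ a, h a ∂π) ^ N ≤ ∫⁻ a, h a ^ N ∂π := by
  have h1 := eLpNorm'_le_eLpNorm'_of_exponent_le (f := h) (μ := π) (p := 1) (q := N) one_pos
    (by exact_mod_cast hN) hh.aestronglyMeasurable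
  simp only [eLpNorm', enorm_eq_self, ENNReal.rpow_one, div_one, ENNReal.rpow_natCast] at h1
  calc _ ≤ _ := pow_le_pow_left' h1 N
    _ = _ := by
      rw [← ENNReal.rpow_natCast, ← ENNReal.rpow_mul, one_div, inv_mul_cancel₀, ENNReal.rpow_one]
      exact_mod_cast (by omega : N ≠ 0)

end Phase

section Moment

variable {Ω : Type*} [MeasurableSpace Ω] {P : Measure Ω} {d n M : ℕ} {X : ℝ → Ω → Ed d}

/-- The integral of the absolute value of the characteristic function at the times `t`,
weighted by `a`. -/
def weightedIntegral (P : Measure Ω) (X : ℝ → Ω → Ed d) (a : (Fin n → Ed d) → ℝ)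
    (t : Fin n → ℝ) : ENNReal :=
  ∫⁻ ξ, ENNReal.ofReal (a ξ * ‖jointCharFun P X t ξ‖)

/-- The random integrand whose integral has expectation `∑ i, weightedIntegral P X a (t i)`. -/
def phasedSum (P : Measure Ω) (X : ℝ → Ω → Ed d) (a : (Fin n → Ed d) → ℝ)
    (t : Fin M → Fin n → ℝ) (ξ : Fin n → Ed d) (ω : Ω) : ℂ :=
  ∑ i, Complex.ofReal (a ξ) * phase (jointCharFun P X (t i) ξ) *
    Complex.exp (Complex.I * Complex.ofReal (∑ k, ⟪ξ k, X (t i k) ω⟫))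

theorem norm_phasedSum_le {a : (Fin n → Ed d) → ℝ} (ha0 : ∀ x, 0 ≤ a x)
    (t : Fin M → Fin n → ℝ) (ξ : Fin n → Ed d) (ω : Ω) :
    ‖phasedSum P X a t ξ ω‖ ≤ M * a ξ := by
  refine (norm_sum_le _ _).trans ?_
  calc _ ≤ ∑ _i : Fin M, a ξ := by
        refine Finset.sum_le_sum fun i _ => ?_
        rw [norm_mul, norm_mul, norm_cexp_I_mul_ofReal, mul_one, Complex.norm_real,
          Real.norm_of_nonneg (ha0 ξ)]
        exact mul_le_of_le_one_right (ha0 ξ) (norm_phase_le _)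
    _ = _ := by simp

theorem measurable_cexp_sum_inner (hmeas : ∀ t, Measurable (X t)) {κ : Type*} [Fintype κ]
    (τ : κ → ℝ) : Measurable fun q : (κ → Ed d) × Ω =>
      Complex.exp (Complex.I * Complex.ofReal (∑ k, ⟪q.1 k, X (τ k) q.2⟫)) := by
  have h (k : κ) : Measurable fun q : (κ → Ed d) × Ω => ⟪q.1 k, X (τ k) q.2⟫ := by
    have := hmeas (τ k)
    fun_prop
  fun_prop

theorem conj_phasedSum (a : (Fin n → Ed d) → ℝ) (t : Fin M → Fin n → ℝ) (ξ : Fin n → Ed d)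
    (ω : Ω) : (starRingEnd ℂ) (phasedSum P X a t ξ ω) =
      ∑ i, Complex.ofReal (a ξ) * (starRingEnd ℂ) (phase (jointCharFun P X (t i) ξ)) *
        Complex.exp (Complex.I * Complex.ofReal (∑ k, ⟪(-ξ) k, X (t i k) ω⟫)) := by
  simp only [phasedSum, map_sum, map_mul, Complex.conj_ofReal, ← Complex.exp_conj, Complex.conj_I,
    Pi.neg_apply, inner_neg_left, Finset.sum_neg_distrib, Complex.ofReal_neg, mul_neg, neg_mul]

variable [IsProbabilityMeasure P]

theorem measurable_jointCharFun (hmeas : ∀ t, Measurable (X t)) {κ : Type*} [Fintype κ]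
    (τ : κ → ℝ) : Measurable fun ξ : κ → Ed d => jointCharFun P X τ ξ :=
  ((measurable_cexp_sum_inner hmeas τ).stronglyMeasurable.integral_prod_right (ν := P)).measurable

theorem norm_jointCharFun_le_one {κ : Type*} [Fintype κ] (τ : κ → ℝ) (ξ : κ → Ed d) :
    ‖jointCharFun P X τ ξ‖ ≤ 1 := by
  have := norm_integral_le_of_norm_le_const (μ := P) (C := 1)
    (f := fun ω => Complex.exp (Complex.I * Complex.ofReal (∑ k, ⟪ξ k, X (τ k) ω⟫)))
    (Eventually.of_forall fun ω => (norm_cexp_I_mul_ofReal _).le)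
  simpa [jointCharFun] using this

theorem measurable_phasedSum (hmeas : ∀ t, Measurable (X t)) {a : (Fin n → Ed d) → ℝ}
    (ha : Measurable a) (t : Fin M → Fin n → ℝ) :
    Measurable fun q : (Fin n → Ed d) × Ω => phasedSum P X a t q.1 q.2 := by
  unfold phasedSum
  refine Finset.measurable_sum _ fun i _ => ?_
  have h1 := measurable_cexp_sum_inner hmeas (t i)
  have h2 : Measurable fun q : (Fin n → Ed d) × Ω => phase (jointCharFun P X (t i) q.1) :=
    (measurable_phase.comp (measurable_jointCharFun hmeas (t i))).comp measurable_fst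
  have h3 : Measurable fun q : (Fin n → Ed d) × Ω => Complex.ofReal (a q.1) :=
    (Complex.measurable_ofReal.comp ha).comp measurable_fst
  exact (h3.mul h2).mul h1

theorem sum_weightedIntegral_le (hmeas : ∀ t, Measurable (X t)) {a : (Fin n → Ed d) → ℝ}
    (ha : Measurable a) (ha0 : ∀ x, 0 ≤ a x) (hai : Integrable a) (t : Fin M → Fin n → ℝ) :
    ∑ i, weightedIntegral P X a (t i) ≤ ∫⁻ ω, ‖∫ ξ, phasedSum P X a t ξ ω‖ₑ ∂P := by
  have hjm (i) := measurable_jointCharFun (P := P) hmeas (t i)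
  have hint (i) : Integrable fun ξ => a ξ * ‖jointCharFun P X (t i) ξ‖ := by
    refine hai.mono' (ha.mul (hjm i).norm).aestronglyMeasurable
      (Eventually.of_forall fun ξ => ?_)
    rw [norm_mul, norm_norm, Real.norm_of_nonneg (ha0 ξ)]
    exact mul_le_of_le_one_right (ha0 ξ) (norm_jointCharFun_le_one _ _)
  have hnn (i) (ξ) : 0 ≤ a ξ * ‖jointCharFun P X (t i) ξ‖ := mul_nonneg (ha0 ξ) (norm_nonneg _)
  have hpi : Integrable (fun q : (Fin n → Ed d) × Ω => phasedSum P X a t q.1 q.2)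
      (volume.prod P) := by
    have h2 : Integrable (fun q : (Fin n → Ed d) × Ω => M * a q.1) (volume.prod P) := by
      simpa using (hai.const_mul (M : ℝ)).mul_prod (integrable_const (μ := P) (1 : ℝ))
    exact h2.mono' (measurable_phasedSum hmeas ha t).aestronglyMeasurable
      (Eventually.of_forall fun q => norm_phasedSum_le ha0 t _ _)
  have h1 : ∫ ω, (∫ ξ, phasedSum P X a t ξ ω) ∂P =
      Complex.ofReal (∑ i, ∫ ξ, a ξ * ‖jointCharFun P X (t i) ξ‖) := by
    rw [integral_integral_swap (f := fun ω ξ => phasedSum P X a t ξ ω) hpi.swap,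
      ← integral_finsetSum _ fun i _ => hint i, ← integral_complex_ofReal]
    refine integral_congr_ae (Eventually.of_forall fun ξ => ?_)
    simp only [phasedSum]
    rw [integral_finsetSum]
    · rw [Complex.ofReal_sum]
      refine Finset.sum_congr rfl fun i _ => ?_
      rw [integral_const_mul, Complex.ofReal_mul, ← phase_mul_self]
      simp only [jointCharFun]
      ring
    · intro i _
      refine Integrable.const_mul ?_ _
      refine Integrable.of_bound (C := 1) ?_ (Eventually.of_forall fun ω =>
        (norm_cexp_I_mul_ofReal _).le)
      exact ((measurable_cexp_sum_inner hmeas (t i)).comp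
        (by fun_prop : Measurable fun ω : Ω => (ξ, ω))).aestronglyMeasurable
  calc ∑ i, weightedIntegral P X a (t i)
      = ‖∫ ω, (∫ ξ, phasedSum P X a t ξ ω) ∂P‖ₑ := by
        rw [h1, ← ofReal_norm, Complex.norm_real, Real.norm_of_nonneg
          (Finset.sum_nonneg fun i _ => integral_nonneg (hnn i)),
          ENNReal.ofReal_sum_of_nonneg fun i _ => integral_nonneg (hnn i)]
        refine Finset.sum_congr rfl fun i _ => ?_
        rw [weightedIntegral, ofReal_integral_eq_lintegral_ofReal (hint i)
          (Eventually.of_forall (hnn i))]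
    _ ≤ _ := enorm_integral_le_lintegral_enorm _

/-- The times `t (J c) j`, indexed by the pairs `(c, j)`. -/
def flatTimes {ι : Type*} (t : Fin M → Fin n → ℝ) (J : ι → Fin M) (q : ι × Fin n) : ℝ :=
  t (J q.1) q.2

/-- The product of the weights `a` and the norm of the joint characteristic function. -/
def pairIntegrand (P : Measure Ω) (X : ℝ → Ω → Ed d) (a : (Fin n → Ed d) → ℝ)
    {ι : Type*} [Fintype ι] (τ : ι × Fin n → ℝ) (ξ : ι × Fin n → Ed d) : ENNReal :=
  ENNReal.ofReal ((∏ c, a fun j => ξ (c, j)) * ‖jointCharFun P X τ ξ‖)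

theorem measurable_pairIntegrand (hmeas : ∀ t, Measurable (X t)) {a : (Fin n → Ed d) → ℝ}
    (ha : Measurable a) {ι : Type*} [Fintype ι] (τ : ι × Fin n → ℝ) :
    Measurable (pairIntegrand P X a τ) := by
  have h := measurable_jointCharFun (P := P) hmeas τ
  unfold pairIntegrand
  fun_prop

theorem enorm_integral_prod_sum_le {ι : Type*} [Fintype ι] [DecidableEq ι]
    (hmeas : ∀ t, Measurable (X t))
    {a : (Fin n → Ed d) → ℝ} (ha0 : ∀ x, 0 ≤ a x) (t : Fin M → Fin n → ℝ)
    (v : ι → Fin M → ℂ) (z : ι → Fin n → Ed d) (hv : ∀ c i, ‖v c i‖ ≤ a (z c)) :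
    ‖∫ ω, ∏ c, ∑ i, v c i *
        Complex.exp (Complex.I * Complex.ofReal (∑ k, ⟪z c k, X (t i k) ω⟫)) ∂P‖ₑ ≤
      ∑ J : ι → Fin M, pairIntegrand P X a (flatTimes t J) (fun q => z q.1 q.2) := by
  have h1 (ω : Ω) : ∏ c, ∑ i, v c i *
        Complex.exp (Complex.I * Complex.ofReal (∑ k, ⟪z c k, X (t i k) ω⟫)) =
      ∑ J : ι → Fin M, (∏ c, v c (J c)) * Complex.exp (Complex.I * Complex.ofReal
        (∑ q : ι × Fin n, ⟪z q.1 q.2, X (flatTimes t J q) ω⟫)) := by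
    rw [Finset.prod_univ_sum, Fintype.piFinset_univ]
    refine Finset.sum_congr rfl fun J _ => ?_
    rw [Finset.prod_mul_distrib, ← Complex.exp_sum, ← Finset.mul_sum, Fintype.sum_prod_type,
      Complex.ofReal_sum]
    rfl
  simp_rw [h1]
  rw [integral_finsetSum]
  · refine (enorm_sum_le _ _).trans (Finset.sum_le_sum fun J _ => ?_)
    rw [integral_const_mul, enorm_mul, pairIntegrand, ENNReal.ofReal_mul
      (Finset.prod_nonneg fun c _ => ha0 _), ← ofReal_norm, ← ofReal_norm, norm_prod]
    refine mul_le_mul_left (ENNReal.ofReal_le_ofReal ?_) _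
    exact Finset.prod_le_prod (fun _ _ => norm_nonneg _) fun c _ => hv c _
  · intro J _
    refine Integrable.const_mul ?_ _
    refine Integrable.of_bound (C := 1) ?_ (Eventually.of_forall fun ω =>
      (norm_cexp_I_mul_ofReal _).le)
    exact ((measurable_cexp_sum_inner hmeas (flatTimes t J)).comp
      (by fun_prop : Measurable fun ω : Ω => ((fun q => z q.1 q.2 : ι × Fin n → Ed d),
        ω))).aestronglyMeasurable

theorem enorm_integral_prod_phasedSum_mul_conj_le {p : ℕ} (hmeas : ∀ t, Measurable (X t))
    {a : (Fin n → Ed d) → ℝ} (ha0 : ∀ x, 0 ≤ a x) (han : ∀ x, a (-x) = a x)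
    (t : Fin M → Fin n → ℝ) (y y' : Fin p → Fin n → Ed d) :
    ‖∫ ω, (∏ c, phasedSum P X a t (y c) ω) *
        (starRingEnd ℂ) (∏ c, phasedSum P X a t (y' c) ω) ∂P‖ₑ ≤
      ∑ J : Fin p ⊕ Fin p → Fin M, pairIntegrand P X a (flatTimes t J) (joinNeg y y') := by
  let v : Fin p ⊕ Fin p → Fin M → ℂ := Sum.elim
    (fun c i => Complex.ofReal (a (y c)) * phase (jointCharFun P X (t i) (y c)))
    (fun c i => Complex.ofReal (a (y' c)) *
      (starRingEnd ℂ) (phase (jointCharFun P X (t i) (y' c))))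
  have hv (c i) : ‖v c i‖ ≤ a (Sum.elim y (-y') c) := by
    rcases c with c | c
    · simp only [v, Sum.elim_inl, norm_mul, Complex.norm_real, Real.norm_of_nonneg (ha0 _)]
      exact mul_le_of_le_one_right (ha0 _) (norm_phase_le _)
    · simp only [v, Sum.elim_inr, norm_mul, Complex.norm_real, Real.norm_of_nonneg (ha0 _),
        RCLike.norm_conj, Pi.neg_apply, han]
      exact mul_le_of_le_one_right (ha0 _) (norm_phase_le _)
  have h := enorm_integral_prod_sum_le (P := P) hmeas ha0 t v (Sum.elim y (-y')) hv
  refine le_trans (le_of_eq ?_) h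
  congr 2
  funext ω
  rw [Fintype.prod_sum_type, map_prod]
  simp only [conj_phasedSum]
  rfl

theorem measurable_single {ι β : Type*} [DecidableEq ι] [AddCommGroup β] [MeasurableSpace β]
    (i : ι) : Measurable (AddMonoidHom.single (fun _ : ι => β) i) :=
  measurable_pi_lambda _ fun j => by
    by_cases h : j = i
    · subst h
      simpa using measurable_id'
    · simp [h]

theorem integrable_prod_pi {p : ℕ} {β : Type*} [MeasurableSpace β] {ρ : Measure β} [SigmaFinite ρ]
    {f : β → ℝ} (hf : Integrable f ρ) :
    Integrable (fun x : Fin p → β => ∏ i, f (x i)) (Measure.pi fun _ => ρ) :=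
  Integrable.fintype_prod (f := fun _ => f) fun _ => hf

set_option maxHeartbeats 2000000 in
theorem pow_sum_weightedIntegral_le {p : ℕ} (hp : 1 ≤ p) (hn : 1 ≤ n)
    (hmeas : ∀ t, Measurable (X t)) {a : (Fin n → Ed d) → ℝ}
    (ha : Measurable a) (ha0 : ∀ x, 0 ≤ a x) (han : ∀ x, a (-x) = a x) (hai : Integrable a)
    {r : ℝ} (har : ∀ x, a x ≠ 0 → ∑ j, ‖x j‖ ≤ r) (t : Fin M → Fin n → ℝ)
    {m : ℕ} (σ₀ : Fin (m + 1) ≃ (Fin p ⊕ Fin p) × Fin n)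
    (σ : (Fin p ⊕ Fin p → Fin M) → (Fin (m + 1) ≃ (Fin p ⊕ Fin p) × Fin n)) :
    (∑ i, weightedIntegral P X a (t i)) ^ (2 * p) ≤
      volume (Metric.closedBall (0 : Ed d) (p * r)) *
        ∑ J : Fin p ⊕ Fin p → Fin M, ∫⁻ x : Fin m → Ed d, pairIntegrand P X a (flatTimes t J)
          (fun k => (Fin.cons (-∑ i, x i) x : Fin (m + 1) → Ed d) ((σ J).symm k)) := by
  let φ : Ed d → ENNReal := fun w =>
    (volume (Metric.closedBall (0 : Ed d) 1))⁻¹ * (Metric.closedBall (0 : Ed d) 1).indicator 1 w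
  have hφ : Measurable φ :=
    measurable_const.mul (measurable_one.indicator Metric.isClosed_closedBall.measurableSet)
  have h1 : ∫⁻ w, φ w = 1 := by
    simp only [φ]
    rw [lintegral_const_mul _ (measurable_one.indicator Metric.isClosed_closedBall.measurableSet),
      lintegral_indicator_one Metric.isClosed_closedBall.measurableSet]
    exact ENNReal.inv_mul_cancel (Metric.measure_closedBall_pos volume _ one_pos).ne'
      measure_closedBall_lt_top.ne
  let c : Ed d →+ (Fin p → Fin n → Ed d) :=
    (AddMonoidHom.single (fun _ : Fin p => Fin n → Ed d) ⟨0, hp⟩).comp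
      (AddMonoidHom.single (fun _ : Fin n => Ed d) ⟨0, hn⟩)
  have hc : Measurable c := by
    exact (measurable_single _).comp (measurable_single _)
  have hsc (w) : sumHom₂ (Fin p) (Fin n) (Ed d) (c w) = w := by
    simp [sumHom₂, c]
  have hΘ := measurePreserving_slice (μ := vol₂ d (Fin p) (Fin n)) measurable_sumHom₂ hc hφ hsc h1
  let B (x : Fin p → Fin n → Ed d) (ω : Ω) : ℂ := ∏ i, phasedSum P X a t (x i) ω
  have hB : Measurable (Function.uncurry B) := by
    have h (i : Fin p) : Measurable fun q : (Fin p → Fin n → Ed d) × Ω =>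
        phasedSum P X a t (q.1 i) q.2 := by
      have h2 : Measurable fun q : (Fin p → Fin n → Ed d) × Ω => (q.1 i, q.2) :=
        ((measurable_pi_apply i).comp measurable_fst).prodMk measurable_snd
      exact (measurable_phasedSum (P := P) hmeas ha t).comp h2
    have h3 : Measurable fun q : (Fin p → Fin n → Ed d) × Ω =>
        ∏ i, phasedSum P X a t (q.1 i) q.2 := by fun_prop
    exact h3
  have hw : Integrable (fun x : Fin p → Fin n → Ed d => ∏ i, (M * a (x i)))
      (vol₂ d (Fin p) (Fin n)) :=
    integrable_prod_pi (hai.const_mul _)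
  have hBw (x ω) : ‖B x ω‖ ≤ ∏ i, (M * a (x i)) := by
    simp only [B, norm_prod]
    exact Finset.prod_le_prod (fun _ _ => norm_nonneg _) fun i _ => norm_phasedSum_le ha0 t _ _
  have hBA : ∀ e ∉ Metric.closedBall (0 : Ed d) (p * r), ∀ y ω,
      B (y - c (sumHom₂ (Fin p) (Fin n) (Ed d) y) + c e) ω = 0 := by
    intro e he y ω
    by_contra h0
    apply he
    set x := y - c (sumHom₂ (Fin p) (Fin n) (Ed d) y) + c e with hx
    have hsx : sumHom₂ (Fin p) (Fin n) (Ed d) x = e := by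
      simp only [hx, map_add, map_sub, hsc]
      simp
    have hne (i : Fin p) : a (x i) ≠ 0 := by
      intro h
      refine Finset.prod_ne_zero_iff.1 h0 i (Finset.mem_univ i) ?_
      have := norm_phasedSum_le (P := P) (X := X) ha0 t (x i) ω
      rw [h, mul_zero] at this
      exact norm_le_zero_iff.1 this
    rw [mem_closedBall_zero_iff, ← hsx, sumHom₂_apply]
    calc _ ≤ ∑ i : Fin p, ∑ k, ‖x i k‖ :=
          (norm_sum_le _ _).trans (Finset.sum_le_sum fun i _ => norm_sum_le _ _)
      _ ≤ ∑ _i : Fin p, r := Finset.sum_le_sum fun i _ => har _ (hne i)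
      _ = _ := by simp
  have key := lintegral_enorm_integral_sq_le_slice (P := P) hΘ hB hw hBw
    Metric.isClosed_closedBall.measurableSet hBA
  have hFm : StronglyMeasurable fun ω => ∫ ξ, phasedSum P X a t ξ ω := by
    have : StronglyMeasurable (Function.uncurry fun (ω : Ω) ξ => phasedSum P X a t ξ ω) :=
      ((measurable_phasedSum hmeas ha t).comp measurable_swap).stronglyMeasurable
    exact this.integral_prod_right
  have hpow (ω : Ω) : ∫ x, B x ω ∂(vol₂ d (Fin p) (Fin n)) =
      (∫ ξ, phasedSum P X a t ξ ω) ^ p := by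
    have := integral_fintype_prod_eq_pow (ι := Fin p) (μ := (volume : Measure (Fin n → Ed d)))
      (fun ξ => phasedSum P X a t ξ ω)
    rw [Fintype.card_fin] at this
    exact this
  calc _ ≤ (∫⁻ ω, ‖∫ ξ, phasedSum P X a t ξ ω‖ₑ ∂P) ^ (2 * p) :=
        pow_le_pow_left' (sum_weightedIntegral_le hmeas ha ha0 hai t) _
    _ ≤ ∫⁻ ω, ‖∫ ξ, phasedSum P X a t ξ ω‖ₑ ^ (2 * p) ∂P :=
        pow_lintegral_le_lintegral_pow hFm.measurable.enorm.aemeasurable (by omega)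
    _ = ∫⁻ ω, ‖∫ x, B x ω ∂(vol₂ d (Fin p) (Fin n))‖ₑ ^ 2 ∂P := by
        refine lintegral_congr fun ω => ?_
        rw [hpow, enorm_pow, ← pow_mul, mul_comm]
    _ ≤ _ := key
    _ ≤ _ := by
        refine mul_le_mul_right ?_ _
        have hpm (J : Fin p ⊕ Fin p → Fin M) :=
          measurable_pairIntegrand (P := P) hmeas ha (flatTimes t J)
        have hslice (J : Fin p ⊕ Fin p → Fin M) :=
          lintegral_slice_pair_joinNeg hφ h1 hc hsc (σ J) (hpm J)
        have hcons : Measurable fun (x : Fin m → Ed d) (k : (Fin p ⊕ Fin p) × Fin n) =>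
            (Fin.cons (-∑ i, x i) x : Fin (m + 1) → Ed d) (σ₀.symm k) := by
          refine measurable_pi_lambda _ fun k => ?_
          refine Fin.cases ?_ (fun i => ?_) (σ₀.symm k)
          · simp only [Fin.cons_zero]
            fun_prop
          · simp only [Fin.cons_succ]
            fun_prop
        calc _ ≤ ∫⁻ x : Fin m → Ed d, (fun ξ => ∑ J : Fin p ⊕ Fin p → Fin M,
                pairIntegrand P X a (flatTimes t J) ξ)
                (fun k => (Fin.cons (-∑ i, x i) x : Fin (m + 1) → Ed d) (σ₀.symm k)) := by
              rw [← lintegral_slice_pair_joinNeg hφ h1 hc hsc σ₀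
                (Finset.measurable_sum _ fun J _ => hpm J)]
              gcongr with w y y'
              exact enorm_integral_prod_phasedSum_mul_conj_le hmeas ha0 han t _ _
          _ = _ := by
              refine (lintegral_finsetSum _ fun J _ => (hpm J).comp hcons).trans ?_
              refine Finset.sum_congr rfl fun J _ => ?_
              exact (lintegral_slice_pair_joinNeg hφ h1 hc hsc σ₀ (hpm J)).symm.trans (hslice J)

end Moment

section UpperIntegral

variable {Y : Type*} [MeasurableSpace Y] {π : Measure Y}

/-- The upper integral: the infimum of the integrals of the measurable majorants of `f`. -/
def upperIntegral (π : Measure Y) (f : Y → ENNReal) : ENNReal :=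
  ⨅ h : {h : Y → ENNReal // Measurable h ∧ f ≤ h}, ∫⁻ y, h.1 y ∂π

theorem upperIntegral_le {f h : Y → ENNReal} (hh : Measurable h) (hf : f ≤ h) :
    upperIntegral π f ≤ ∫⁻ y, h y ∂π :=
  iInf_le (fun h : {h : Y → ENNReal // Measurable h ∧ f ≤ h} => ∫⁻ y, h.1 y ∂π) ⟨h, hh, hf⟩

theorem exists_measurable_lintegral_le_upperIntegral (π : Measure Y) (f : Y → ENNReal) :
    ∃ h, Measurable h ∧ f ≤ h ∧ ∫⁻ y, h y ∂π ≤ upperIntegral π f := by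
  have : Nonempty {h : Y → ENNReal // Measurable h ∧ f ≤ h} :=
    ⟨fun _ => ⊤, measurable_const, fun _ => le_top⟩
  obtain ⟨g, hg, hgr⟩ := exists_seq_tendsto_sInf
    (range_nonempty fun h : {h : Y → ENNReal // Measurable h ∧ f ≤ h} => ∫⁻ y, h.1 y ∂π)
    (OrderBot.bddBelow _)
  choose h hh using hgr.2
  refine ⟨fun y => ⨅ n, (h n).1 y, Measurable.iInf fun n => (h n).2.1,
    fun y => le_iInf fun n => (h n).2.2 y, ?_⟩
  refine ge_of_tendsto' hgr.1 fun n => ?_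
  rw [← hh n]
  exact lintegral_mono fun y => iInf_le _ n

theorem lintegral_tsum_le_tsum_upperIntegral {f : Y → ENNReal} {g : ℕ → Y → ENNReal}
    {c : ℕ → ENNReal} (hf : ∀ᵐ y ∂π, f y ≤ ∑' k, c k * g k y) :
    ∫⁻ y, f y ∂π ≤ ∑' k, c k * upperIntegral π (g k) := by
  choose h hh hgh hint using fun k => exists_measurable_lintegral_le_upperIntegral π (g k)
  calc _ ≤ ∫⁻ y, ∑' k, c k * h k y ∂π := by
        refine lintegral_mono_ae (hf.mono fun y hy => hy.trans ?_)
        exact ENNReal.tsum_le_tsum fun k => mul_le_mul_right (hgh k y) _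
    _ = ∑' k, c k * ∫⁻ y, h k y ∂π := by
        rw [lintegral_tsum fun k => ((hh k).const_mul _).aemeasurable]
        exact tsum_congr fun k => lintegral_const_mul _ (hh k)
    _ ≤ _ := ENNReal.tsum_le_tsum fun k => mul_le_mul_right (hint k) _

theorem add_mul_upperIntegral_le [IsProbabilityMeasure π] {f : Y → ENNReal} {M : ℕ} :
    ∀ {c : ENNReal} {B : (Fin M → Y) → ENNReal}, Measurable B →
      (∀ t, c + ∑ i, f (t i) ≤ B t) →
      c + M * upperIntegral π f ≤ ∫⁻ t, B t ∂(Measure.pi fun _ => π) := by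
  induction M with
  | zero =>
    intro c B _ h
    calc c + (0 : ℕ) * upperIntegral π f = ∫⁻ _t : Fin 0 → Y, c ∂(Measure.pi fun _ => π) := by
          simp
      _ ≤ _ := lintegral_mono fun t => by simpa using h t
  | succ M ih =>
    intro c B hB h
    have hcm : Measurable fun q : Y × (Fin M → Y) => B (Fin.cons q.1 q.2) := by
      refine hB.comp (measurable_pi_lambda _ fun k => ?_)
      refine Fin.cases ?_ (fun i => ?_) k
      · simpa using measurable_fst
      · simp only [Fin.cons_succ]
        fun_prop
    let B' : Y → ENNReal := fun a => ∫⁻ y, B (Fin.cons a y) ∂(Measure.pi fun _ => π)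
    have hB' : Measurable B' := hcm.lintegral_prod_right'
    have h1 (a : Y) : c + M * upperIntegral π f + f a ≤ B' a := by
      have := ih (c := c + f a) (hcm.comp (measurable_prodMk_left (x := a))) fun t => by
        simpa [Fin.sum_univ_succ, add_assoc] using h (Fin.cons a t)
      rwa [add_right_comm] at this
    rw [lintegral_cons π hB]
    change _ ≤ ∫⁻ a, B' a ∂π
    generalize hb : c + M * upperIntegral π f = b at h1
    rw [Nat.cast_succ, add_mul, one_mul, ← add_assoc, hb]
    have h2 (a : Y) : b ≤ B' a := le_self_add.trans (h1 a)
    rcases eq_or_ne b ⊤ with rfl | hbt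
    · calc _ ≤ ∫⁻ _a : Y, (⊤ : ENNReal) ∂π := by simp
        _ ≤ _ := lintegral_mono h2
    · calc _ ≤ ∫⁻ _a : Y, b ∂π + ∫⁻ a, (B' a - b) ∂π := by
            refine add_le_add (by simp) (upperIntegral_le (hB'.sub_const b) fun a => ?_)
            exact ENNReal.le_sub_of_add_le_left hbt (h1 a)
        _ = ∫⁻ a, (b + (B' a - b)) ∂π := (lintegral_add_left measurable_const _).symm
        _ = _ := lintegral_congr fun a => add_tsub_cancel_of_le (h2 a)

end UpperIntegral

section Sampling

theorem measurePreserving_comp_injective {ι κ α : Type*} [Fintype ι] [Fintype κ]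
    [MeasurableSpace α] (ν : Measure α) [IsProbabilityMeasure ν] {J : ι → κ}
    (hJ : Function.Injective J) :
    MeasurePreserving (fun (x : κ → α) (i : ι) => x (J i))
      (Measure.pi fun _ => ν) (Measure.pi fun _ => ν) := by
  have hm : Measurable (fun (x : κ → α) (i : ι) => x (J i)) := by fun_prop
  refine ⟨hm, (Measure.pi_eq fun S hS => ?_).symm⟩
  rw [Measure.map_apply hm (MeasurableSet.univ_pi hS)]
  have : (fun (x : κ → α) (i : ι) => x (J i)) ⁻¹' (univ.pi S)
      = univ.pi (Function.extend J S fun _ => univ) := by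
    ext x
    simp only [mem_preimage, mem_univ_pi]
    refine ⟨fun h k => ?_, fun h i => by simpa [hJ.extend_apply] using h (J i)⟩
    by_cases hk : ∃ i, J i = k
    · obtain ⟨i, rfl⟩ := hk
      simpa [hJ.extend_apply] using h i
    · simp [Function.extend_apply' _ _ _ hk]
  rw [this, Measure.pi_pi]
  refine (Fintype.prod_of_injective J hJ _ _ (fun k hk => ?_) fun i => ?_).symm
  · simp [Function.extend_apply' S (fun _ => univ) k (by simpa using hk)]
  · simp [hJ.extend_apply]

theorem card_not_injective_le {ι : Type*} [Fintype ι] [DecidableEq ι] (M : ℕ) :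
    (Finset.univ.filter fun J : ι → Fin M => ¬ Function.Injective J).card ≤
      Fintype.card ι ^ 2 * M ^ (Fintype.card ι - 1) := by
  have hsub : (Finset.univ.filter fun J : ι → Fin M => ¬ Function.Injective J) ⊆
      (Finset.univ : Finset (ι × ι)).biUnion fun q =>
        Finset.univ.filter fun J : ι → Fin M => J q.1 = J q.2 ∧ q.1 ≠ q.2 := by
    intro J hJ
    simp only [Function.Injective, not_forall, Finset.mem_filter, Finset.mem_univ, true_and] at hJ
    obtain ⟨a, b, h, hab⟩ := hJ
    simp only [Finset.mem_biUnion, Finset.mem_filter, Finset.mem_univ, true_and]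
    exact ⟨(a, b), h, hab⟩
  refine (Finset.card_le_card hsub).trans (Finset.card_biUnion_le.trans ?_)
  have hq (q : ι × ι) :
      (Finset.univ.filter fun J : ι → Fin M => J q.1 = J q.2 ∧ q.1 ≠ q.2).card ≤
        M ^ (Fintype.card ι - 1) := by
    have : Fintype.card ({i // i ≠ q.1} → Fin M) = M ^ (Fintype.card ι - 1) := by
      simp [Fintype.card_subtype_compl]
    rw [← this, ← Finset.card_univ]
    refine Finset.card_le_card_of_injOn (fun J i => J i)
      (fun _ _ => Finset.mem_coe.2 (Finset.mem_univ _)) ?_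
    intro J hJ J' hJ' h
    simp only [Finset.coe_filter, Finset.mem_univ, true_and, mem_ofPred_eq] at hJ hJ'
    funext i
    by_cases hi : i = q.1
    · subst hi
      rw [hJ.1, hJ'.1]
      exact congrFun h ⟨q.2, hJ.2.symm⟩
    · exact congrFun h ⟨i, hi⟩
  calc _ ≤ ∑ _q : ι × ι, M ^ (Fintype.card ι - 1) := Finset.sum_le_sum fun q _ => hq q
    _ = _ := by simp [sq]

theorem ENNReal.le_of_forall_mul_nat_le {a b c : ENNReal} (hc : c ≠ ⊤)
    (h : ∀ M : ℕ, 1 ≤ M → a * M ≤ b * M + c) : a ≤ b := by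
  have hlim : Tendsto (fun M : ℕ => b + c * (M : ENNReal)⁻¹) atTop (𝓝 (b + c * 0)) :=
    tendsto_const_nhds.add
      (ENNReal.Tendsto.const_mul ENNReal.tendsto_inv_nat_nhds_zero (Or.inr hc))
  rw [mul_zero, add_zero] at hlim
  refine ge_of_tendsto hlim (eventually_atTop.2 ⟨1, fun M hM => ?_⟩)
  have hM0 : (M : ENNReal) ≠ 0 := by exact_mod_cast (by omega : M ≠ 0)
  have := h M hM
  calc a = a * M * (M : ENNReal)⁻¹ := by
        rw [mul_assoc, ENNReal.mul_inv_cancel hM0 (ENNReal.natCast_ne_top M), mul_one]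
    _ ≤ (b * M + c) * (M : ENNReal)⁻¹ := by gcongr
    _ = _ := by
        rw [add_mul, mul_assoc, ENNReal.mul_inv_cancel hM0 (ENNReal.natCast_ne_top M), mul_one]

theorem upperIntegral_pow_le {ι : Type*} [Fintype ι] [DecidableEq ι] [Nonempty ι] {n : ℕ}
    {ν : Measure ℝ} [IsProbabilityMeasure ν] {f : (Fin n → ℝ) → ENNReal}
    {G : (ι × Fin n → ℝ) → ENNReal} (hG : Measurable G) {V K : ENNReal} (hV : V ≠ ⊤) (hK : K ≠ ⊤)
    (h : ∀ (M : ℕ) (t : Fin M → Fin n → ℝ), (∑ i, f (t i)) ^ Fintype.card ι ≤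
      V * ((∑ J : ι → Fin M with Function.Injective J, G (flatTimes t J)) +
        ∑ J : ι → Fin M with ¬ Function.Injective J, K)) :
    upperIntegral (Measure.pi fun _ => ν) f ^ Fintype.card ι ≤
      V * ∫⁻ τ, G τ ∂(Measure.pi fun _ => ν) := by
  set N := Fintype.card ι with hN
  have hN0 : 1 ≤ N := Fintype.card_pos
  set π : Measure (Fin n → ℝ) := Measure.pi fun _ => ν
  have hft {M : ℕ} (J : ι → Fin M) : Measurable fun t : Fin M → Fin n → ℝ => flatTimes t J := by
    unfold flatTimes
    fun_prop
  refine ENNReal.le_of_forall_mul_nat_le (c := V * (N ^ 2 * K)) (by finiteness) fun M hM => ?_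
  let S : (Fin M → Fin n → ℝ) → ENNReal := fun t =>
    V * ((∑ J : ι → Fin M with Function.Injective J, G (flatTimes t J)) +
      ∑ J : ι → Fin M with ¬ Function.Injective J, K)
  have hS1 : Measurable fun t : Fin M → Fin n → ℝ =>
      ∑ J : ι → Fin M with Function.Injective J, G (flatTimes t J) :=
    Finset.measurable_sum _ fun J _ => hG.comp (hft J)
  have hS : Measurable S := (hS1.add_const _).const_mul V
  have hroot (x : ENNReal) : (x ^ (N : ℝ)⁻¹) ^ N = x := by
    rw [← ENNReal.rpow_natCast, ← ENNReal.rpow_mul, inv_mul_cancel₀, ENNReal.rpow_one]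
    exact_mod_cast (by omega : N ≠ 0)
  have hB : Measurable fun t => S t ^ (N : ℝ)⁻¹ := hS.pow_const _
  have h1 := add_mul_upperIntegral_le (π := π) (f := f) (c := 0) hB fun t => by
    rw [zero_add]
    rw [ENNReal.le_rpow_inv_iff (by exact_mod_cast hN0), ENNReal.rpow_natCast]
    exact h M t
  rw [zero_add] at h1
  have h2 : (M * upperIntegral π f) ^ N ≤ ∫⁻ t, S t ∂(Measure.pi fun _ => π) := by
    refine (pow_le_pow_left' h1 N).trans ((pow_lintegral_le_lintegral_pow hB.aemeasurable
      hN0).trans_eq ?_)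
    exact lintegral_congr fun t => hroot _
  have h3 : ∫⁻ t, S t ∂(Measure.pi fun _ => π) ≤
      V * (M ^ N * ∫⁻ τ, G τ ∂(Measure.pi fun _ => ν) + (N ^ 2 * M ^ (N - 1)) * K) := by
    rw [lintegral_const_mul _ (hS1.add_const _), lintegral_add_left hS1, lintegral_const,
      measure_univ, mul_one]
    refine mul_le_mul_right (add_le_add ?_ ?_) V
    · calc _ = ∑ J : ι → Fin M with Function.Injective J, ∫⁻ τ, G τ ∂(Measure.pi fun _ => ν) := by
            refine (lintegral_finsetSum _ fun J _ => hG.comp (hft J)).trans ?_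
            refine Finset.sum_congr rfl fun J hJ => ?_
            have h4 : MeasurePreserving (fun t : Fin M → Fin n → ℝ => flatTimes t J)
                (Measure.pi fun _ => π) (Measure.pi fun _ => ν) :=
              (measurePreserving_uncurry ν).comp
                (measurePreserving_comp_injective π (Finset.mem_filter.1 hJ).2)
            exact h4.lintegral_comp hG
        _ ≤ ∑ J : ι → Fin M, ∫⁻ τ, G τ ∂(Measure.pi fun _ => ν) :=
            Finset.sum_le_sum_of_subset (Finset.filter_subset _ _)
        _ = _ := by simp [hN]
    · rw [Finset.sum_const, nsmul_eq_mul]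
      gcongr
      exact_mod_cast card_not_injective_le M
  have hMN : (M : ENNReal) ^ N = M ^ (N - 1) * M := by
    rw [← pow_succ, Nat.sub_add_cancel hN0]
  have hM0 : (M : ENNReal) ^ (N - 1) ≠ 0 :=
    pow_ne_zero _ (by exact_mod_cast (by omega : M ≠ 0))
  have hMt : (M : ENNReal) ^ (N - 1) ≠ ⊤ := by finiteness
  refine (ENNReal.mul_le_mul_iff_right hM0 hMt).1 ?_
  calc _ = (M * upperIntegral π f) ^ N := by
        rw [mul_pow, hMN]
        ring
    _ ≤ _ := h2.trans h3
    _ = _ := by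
        rw [hMN]
        ring

end Sampling

section Dyadic

variable {d n : ℕ}

/-- The `e`-th power of the product of the weights, restricted to the `k`-th dyadic shell. -/
def dyadicWeight (ρ e : ℝ) (k : ℕ) (ξ : Fin n → Ed d) : ℝ :=
  {ξ : Fin n → Ed d | ∏ j, weight ρ (ξ j) ∈ Ico (2 ^ k : ℝ) (2 ^ (k + 1))}.indicator
    (fun ξ => (∏ j, weight ρ (ξ j)) ^ e) ξ

variable {ρ e : ℝ} {k : ℕ}

theorem measurable_prod_weight : Measurable fun ξ : Fin n → Ed d => ∏ j, weight ρ (ξ j) := by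
  have := measurable_weight (d := d) ρ
  fun_prop

theorem measurable_dyadicWeight : Measurable (dyadicWeight ρ e k : (Fin n → Ed d) → ℝ) :=
  (measurable_prod_weight.pow_const e).indicator (measurable_prod_weight measurableSet_Ico)

theorem prod_weight_pos (hρ : 0 ≤ ρ) (ξ : Fin n → Ed d) : 0 < ∏ j, weight ρ (ξ j) :=
  Finset.prod_pos fun _ _ => weight_pos hρ _

theorem dyadicWeight_nonneg (hρ : 0 ≤ ρ) (ξ : Fin n → Ed d) : 0 ≤ dyadicWeight ρ e k ξ :=
  indicator_nonneg (fun ξ _ => Real.rpow_nonneg (prod_weight_pos hρ ξ).le e) ξ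

theorem dyadicWeight_neg (ξ : Fin n → Ed d) : dyadicWeight ρ e k (-ξ) = dyadicWeight ρ e k ξ := by
  simp [dyadicWeight, indicator, weight]

theorem dyadicWeight_le_rpow (hρ : 0 ≤ ρ) (ξ : Fin n → Ed d) :
    dyadicWeight ρ e k ξ ≤ (∏ j, weight ρ (ξ j)) ^ e :=
  indicator_le_self' (fun ξ _ => Real.rpow_nonneg (prod_weight_pos hρ ξ).le e) ξ

theorem dyadicWeight_le (hρ : 0 ≤ ρ) (he : 0 ≤ e) (ξ : Fin n → Ed d) :
    dyadicWeight ρ e k ξ ≤ (2 ^ (k + 1)) ^ e := by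
  refine indicator_apply_le' (fun h => ?_) fun _ => by positivity
  exact Real.rpow_le_rpow (prod_weight_pos hρ ξ).le h.2.le he

theorem sum_norm_le_of_dyadicWeight_ne_zero (hρ : 0 < ρ) {ξ : Fin n → Ed d}
    (h : dyadicWeight ρ e k ξ ≠ 0) : ∑ j, ‖ξ j‖ ≤ 2 ^ (k + 1) / ρ := by
  have h1 := (mem_of_indicator_ne_zero h).2
  have h2 := one_add_sum_le_prod_one_add Finset.univ
    fun j => mul_nonneg hρ.le (norm_nonneg (ξ j))
  rw [← Finset.mul_sum] at h2
  rw [le_div_iff₀' hρ]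
  unfold weight at h1
  linarith

theorem integrable_dyadicWeight (hρ : 0 < ρ) (he : 0 ≤ e) :
    Integrable (dyadicWeight ρ e k : (Fin n → Ed d) → ℝ) := by
  have h1 : Integrable ((Metric.closedBall (0 : Fin n → Ed d) (2 ^ (k + 1) / ρ)).indicator
      fun _ => ((2 : ℝ) ^ (k + 1)) ^ e) :=
    (integrable_indicator_iff Metric.isClosed_closedBall.measurableSet).2
      (integrableOn_const measure_closedBall_lt_top.ne)
  refine h1.mono' measurable_dyadicWeight.aestronglyMeasurable (Eventually.of_forall fun ξ => ?_)
  rw [Real.norm_of_nonneg (dyadicWeight_nonneg hρ.le ξ)]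
  by_cases h : dyadicWeight ρ e k ξ = 0
  · rw [h]
    exact indicator_nonneg (fun _ _ => by positivity) ξ
  · rw [indicator_of_mem]
    · exact dyadicWeight_le hρ.le he ξ
    · rw [mem_closedBall_zero_iff, pi_norm_le_iff_of_nonneg (by positivity)]
      exact fun j => (Finset.single_le_sum (f := fun j => ‖ξ j‖) (fun _ _ => norm_nonneg _)
        (Finset.mem_univ j)).trans (sum_norm_le_of_dyadicWeight_ne_zero hρ h)

theorem exists_prod_rpow_norm_le_dyadicWeight {η δ : ℝ} (hρ : 0 < ρ) (hη : 0 ≤ η) (hδ : 0 ≤ δ)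
    (ξ : Fin n → Ed d) : ∃ k : ℕ, ∏ j, ‖ξ j‖ ^ η ≤
      ρ ^ (-(η * n)) * ((2 ^ k : ℝ) ^ (-δ) * dyadicWeight ρ (η + δ) k ξ) := by
  set W := ∏ j, weight ρ (ξ j) with hW
  have hW0 : 0 < W := prod_weight_pos hρ.le ξ
  have hW1 : 1 ≤ W := Finset.one_le_prod fun j _ => one_le_weight hρ.le _
  obtain ⟨k, hk, hk'⟩ := exists_nat_pow_near hW1 one_lt_two
  refine ⟨k, ?_⟩
  have h1 : dyadicWeight ρ (η + δ) k ξ = W ^ (η + δ) := by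
    rw [dyadicWeight, indicator_of_mem]
    exact ⟨hk, hk'⟩
  rw [h1, Real.rpow_add hW0]
  have h2 : 1 ≤ (2 ^ k : ℝ) ^ (-δ) * W ^ δ := by
    rw [Real.rpow_neg (by positivity), ← div_eq_inv_mul, one_le_div (by positivity)]
    exact Real.rpow_le_rpow (by positivity) hk hδ
  have h3 : ∏ j, ‖ξ j‖ ^ η ≤ ρ ^ (-(η * n)) * W ^ η := by
    calc _ ≤ ∏ j, ρ ^ (-η) * weight ρ (ξ j) ^ η := by
          refine Finset.prod_le_prod (fun _ _ => by positivity) fun j _ => ?_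
          rw [Real.rpow_neg hρ.le, ← div_eq_inv_mul, ← Real.div_rpow (weight_pos hρ.le _).le hρ.le]
          refine Real.rpow_le_rpow (norm_nonneg _) ?_ hη
          rw [le_div_iff₀' hρ, weight]
          linarith
      _ = _ := by
          rw [Finset.prod_mul_distrib, Finset.prod_const, Finset.card_univ, Fintype.card_fin,
            Real.finsetProd_rpow _ _ fun j _ => (weight_pos hρ.le _).le, ← Real.rpow_natCast,
            ← Real.rpow_mul hρ.le, neg_mul]
  calc _ ≤ ρ ^ (-(η * n)) * W ^ η := h3
    _ ≤ ρ ^ (-(η * n)) * W ^ η * ((2 ^ k : ℝ) ^ (-δ) * W ^ δ) :=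
        le_mul_of_one_le_right (by positivity) h2
    _ = _ := by ring

end Dyadic

section Uniform

variable {κ : Type*} [Fintype κ]

theorem pi_unif (u U : ℝ) : Measure.pi (fun _ : κ => unif u U) =
    ENNReal.ofReal (U - u)⁻¹ ^ Fintype.card κ •
      (volume : Measure (κ → ℝ)).restrict (univ.pi fun _ => Icc u U) := by
  have : IsFiniteMeasure (unif u U) :=
    (volume.restrict (Icc u U)).smul_finite ENNReal.ofReal_ne_top
  refine Measure.pi_eq fun S hS => ?_
  rw [volume_pi, Measure.restrict_pi_pi, Measure.smul_apply, Measure.pi_pi, smul_eq_mul]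
  simp only [unif, Measure.smul_apply, smul_eq_mul]
  rw [Finset.prod_mul_distrib, Finset.prod_const, Finset.card_univ]

theorem ae_pi_unif_good (u U T : ℝ) (hUT : U ≤ T) :
    ∀ᵐ τ ∂(Measure.pi fun _ : κ => unif u U), Function.Injective τ ∧ (∀ k, τ k ∈ Icc u U) ∧
      ∀ k, τ k < T := by
  have hne (k : κ) : ∀ᵐ τ : κ → ℝ, τ k ≠ T :=
    Measure.ae_eval_ne (μ := fun _ : κ => (volume : Measure ℝ)) k T
  have hinj (k l : κ) (hkl : k ≠ l) : ∀ᵐ τ : κ → ℝ, τ k ≠ τ l := by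
    classical
    have h := Measure.addHaar_submodule (volume : Measure (κ → ℝ))
      (LinearMap.ker ((LinearMap.proj k : (κ → ℝ) →ₗ[ℝ] ℝ) - LinearMap.proj l)) fun h => by
        have h1 : (Pi.single k 1 : κ → ℝ) ∈ (⊤ : Submodule ℝ (κ → ℝ)) := trivial
        rw [← h] at h1
        simp [hkl] at h1
    rw [ae_iff]
    convert h using 2
    ext τ
    simp [sub_eq_zero]
  have hinj' : ∀ᵐ τ : κ → ℝ, ∀ k l, k ≠ l → τ k ≠ τ l := by
    simp only [ae_all_iff]
    exact hinj
  rw [pi_unif]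
  refine Measure.ae_smul_measure ?_ _
  filter_upwards [ae_restrict_of_ae (ae_all_iff.2 hne), ae_restrict_of_ae hinj',
    ae_restrict_mem (MeasurableSet.univ_pi fun _ => measurableSet_Icc)] with τ h1 h2 h3
  refine ⟨fun k l h => by_contra fun hkl => h2 k l hkl h, fun k => h3 k trivial, fun k => ?_⟩
  exact lt_of_le_of_ne ((h3 k trivial).2.trans hUT) (h1 k)

end Uniform

section Shell

variable {Ω : Type*} [MeasurableSpace Ω] {P : Measure Ω} {d n m : ℕ} {X : ℝ → Ω → Ed d}

theorem pairIntegrand_dyadicWeight_le {ι : Type*} [Fintype ι] {ρ e : ℝ} {k : ℕ} (hρ : 0 ≤ ρ)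
    (τ : ι × Fin n → ℝ) (ξ : ι × Fin n → Ed d) :
    pairIntegrand P X (dyadicWeight ρ e k) τ ξ ≤
      ENNReal.ofReal ((∏ q, weight ρ (ξ q)) ^ e * ‖jointCharFun P X τ ξ‖) := by
  refine ENNReal.ofReal_le_ofReal (mul_le_mul_of_nonneg_right ?_ (norm_nonneg _))
  rw [Fintype.prod_prod_type, ← Real.finsetProd_rpow _ _ fun c _ => (prod_weight_pos hρ _).le]
  exact Finset.prod_le_prod (fun _ _ => dyadicWeight_nonneg hρ _)
    fun _ _ => dyadicWeight_le_rpow hρ _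

variable [IsProbabilityMeasure P]

theorem lintegral_pairIntegrand_le_const {ι : Type*} [Fintype ι] {a : (Fin n → Ed d) → ℝ}
    {A r : ℝ} (ha0 : ∀ x, 0 ≤ a x) (haA : ∀ x, a x ≤ A) (hr : 0 ≤ r)
    (har : ∀ x, a x ≠ 0 → ∑ j, ‖x j‖ ≤ r) (τ : ι × Fin n → ℝ) (σ : Fin (m + 1) ≃ ι × Fin n) :
    ∫⁻ x : Fin m → Ed d, pairIntegrand P X a τ
        (fun k => (Fin.cons (-∑ i, x i) x : Fin (m + 1) → Ed d) (σ.symm k)) ≤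
      ENNReal.ofReal (A ^ Fintype.card ι) * volume (Metric.closedBall (0 : Fin m → Ed d) r) := by
  rw [← lintegral_indicator_const Metric.isClosed_closedBall.measurableSet]
  refine lintegral_mono fun x => ?_
  set ξ : ι × Fin n → Ed d :=
    fun k => (Fin.cons (-∑ i, x i) x : Fin (m + 1) → Ed d) (σ.symm k) with hξ
  by_cases h0 : ∏ c, (a fun j => ξ (c, j)) = 0
  · simp [pairIntegrand, h0]
  rw [indicator_of_mem]
  · refine ENNReal.ofReal_le_ofReal ?_
    calc _ ≤ ∏ c, a fun j => ξ (c, j) :=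
          mul_le_of_le_one_right (Finset.prod_nonneg fun _ _ => ha0 _)
            (norm_jointCharFun_le_one _ _)
      _ ≤ ∏ _c : ι, A := Finset.prod_le_prod (fun _ _ => ha0 _) fun _ _ => haA _
      _ = _ := by simp
  · rw [mem_closedBall_zero_iff, pi_norm_le_iff_of_nonneg hr]
    intro i
    have hi : x i = ξ ((σ i.succ).1, (σ i.succ).2) := by simp [hξ]
    rw [hi]
    exact (Finset.single_le_sum (f := fun j => ‖ξ ((σ i.succ).1, j)‖) (fun _ _ => norm_nonneg _)
      (Finset.mem_univ _)).trans
        (har _ (Finset.prod_ne_zero_iff.1 h0 (σ i.succ).1 (Finset.mem_univ _)))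

/-- The bound for the moment of order `m + 1` in terms of the constants of the process. -/
def momentBound (d m : ℕ) (C α θ e lam R : ℝ) : ENNReal :=
  ENNReal.ofReal (C ^ (m + 1) * ((m + 1 : ℕ) : ℝ) ^ (α * θ * ((m + 1 : ℕ) : ℝ))) *
    ENNReal.ofReal (Real.exp (lam * R)) * ((m + 1).factorial *
      ENNReal.ofReal (R⁻¹ * (lam ^ (α * d) * lam⁻¹ * gapConst d α e)) ^ m)

theorem upperIntegral_weightedIntegral_pow_le (hmeas : ∀ t, Measurable (X t))
    {C T α θ lam e u U : ℝ} (hC0 : 0 < C) (hC : IncrementBound P X T α θ C) (hlam : 0 < lam)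
    (hα : 0 < α) (he : 0 ≤ e) (he1 : e ≤ 1) (h : α * (d + 2 * e) < 1) (hu0 : 0 < u) (hu : u < U)
    (hUT : U ≤ T) {p : ℕ} (hp : 1 ≤ p) (hn : 1 ≤ n) (hm : 2 * p * n = m + 1) (k : ℕ) :
    upperIntegral (Measure.pi fun _ => unif u U)
        (weightedIntegral P X (dyadicWeight (n := n) (lam ^ (-α)) e k)) ^ (2 * p) ≤
      volume (Metric.closedBall (0 : Ed d) (p * (2 ^ (k + 1) / lam ^ (-α)))) *
        momentBound d m C α θ e lam (U - u) := by
  classical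
  have := isProbabilityMeasure_unif hu
  have hρ : 0 < lam ^ (-α) := by positivity
  set ρ := lam ^ (-α) with hρdef
  have hι : Fintype.card (Fin p ⊕ Fin p) = 2 * p := by simp [two_mul]
  have hκ : Fintype.card ((Fin p ⊕ Fin p) × Fin n) = m + 1 := by
    rw [Fintype.card_prod, hι, Fintype.card_fin, hm]
  have : Nonempty (Fin p ⊕ Fin p) := ⟨Sum.inl ⟨0, hp⟩⟩
  let σ₀ : Fin (m + 1) ≃ (Fin p ⊕ Fin p) × Fin n := (Fintype.equivFinOfCardEq hκ).symm
  let good : Set ((Fin p ⊕ Fin p) × Fin n → ℝ) :=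
    {τ | Function.Injective τ ∧ (∀ k, τ k ∈ Icc u U) ∧ ∀ k, τ k < T}
  let bad := toMeasurable (Measure.pi fun _ => unif u U) goodᶜ
  have hbad : Measure.pi (fun _ => unif u U) bad = 0 := by
    rw [measure_toMeasurable]
    exact ae_pi_unif_good u U T hUT
  let K₀ := ENNReal.ofReal (C ^ (m + 1) * ((m + 1 : ℕ) : ℝ) ^ (α * θ * ((m + 1 : ℕ) : ℝ))) *
    ENNReal.ofReal (Real.exp (lam * (U - u)))
  let G : ((Fin p ⊕ Fin p) × Fin n → ℝ) → ENNReal := fun τ =>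
    K₀ * gapSum d m α e lam τ + bad.indicator (fun _ => ⊤) τ
  have hgm := measurable_gapSum (κ := (Fin p ⊕ Fin p) × Fin n) (d := d) (m := m) α e lam
  have hbm : MeasurableSet bad := measurableSet_toMeasurable _ _
  have hG : Measurable G := (hgm.const_mul _).add (measurable_const.indicator hbm)
  have hGσ (τ : (Fin p ⊕ Fin p) × Fin n → ℝ) : ∃ σ : Fin (m + 1) ≃ (Fin p ⊕ Fin p) × Fin n,
      ∫⁻ x : Fin m → Ed d, pairIntegrand P X (dyadicWeight ρ e k) τ
        (fun k => (Fin.cons (-∑ i, x i) x : Fin (m + 1) → Ed d) (σ.symm k)) ≤ G τ := by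
    by_cases hτ : τ ∈ bad
    · refine ⟨σ₀, ?_⟩
      simp only [G, indicator_of_mem hτ, add_top]
      exact le_top
    · have hg : τ ∈ good := by_contra fun h => hτ (subset_toMeasurable _ _ h)
      obtain ⟨σ, hσ⟩ := exists_equiv_lintegral_le_gapSum hκ hmeas hC0 hC hlam hα he he1 hu0
        hg.1 hg.2.1 hg.2.2
      refine ⟨σ, le_trans ?_ (hσ.trans le_self_add)⟩
      exact lintegral_mono fun x => pairIntegrand_dyadicWeight_le hρ.le τ _
  choose σ hσ using hGσ
  have hGint : ∫⁻ τ, G τ ∂(Measure.pi fun _ => unif u U) ≤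
      momentBound d m C α θ e lam (U - u) := by
    rw [lintegral_add_left (hgm.const_mul _), lintegral_const_mul _ hgm,
      lintegral_indicator_const hbm, hbad, mul_zero, add_zero]
    exact mul_le_mul_right (lintegral_gapSum_le hκ h hlam hu) _
  rw [← hι]
  refine (upperIntegral_pow_le hG (V := volume (Metric.closedBall (0 : Ed d)
    (p * (2 ^ (k + 1) / ρ)))) (K := ENNReal.ofReal (((2 ^ (k + 1)) ^ e) ^ (2 * p)) *
      volume (Metric.closedBall (0 : Fin m → Ed d) (2 ^ (k + 1) / ρ)))
    measure_closedBall_lt_top.ne (ENNReal.mul_ne_top ENNReal.ofReal_ne_top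
      measure_closedBall_lt_top.ne) fun M t => ?_).trans (mul_le_mul_right hGint _)
  rw [hι]
  refine (pow_sum_weightedIntegral_le hp hn hmeas measurable_dyadicWeight
    (dyadicWeight_nonneg hρ.le) dyadicWeight_neg (integrable_dyadicWeight hρ he)
    (fun x => sum_norm_le_of_dyadicWeight_ne_zero hρ) t σ₀ fun J => σ (flatTimes t J)).trans
    (mul_le_mul_right ?_ _)
  rw [← Finset.sum_filter_add_sum_filter_not Finset.univ
    fun J : Fin p ⊕ Fin p → Fin M => Function.Injective J]
  refine add_le_add (Finset.sum_le_sum fun J _ => hσ _) (Finset.sum_le_sum fun J _ => ?_)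
  rw [← hι]
  exact lintegral_pairIntegrand_le_const (dyadicWeight_nonneg hρ.le) (dyadicWeight_le hρ.le he)
    (by positivity) (fun x => sum_norm_le_of_dyadicWeight_ne_zero hρ) _ _

theorem lintegral_prod_rpow_norm_le_tsum (hmeas : ∀ t, Measurable (X t)) {ρ η δ : ℝ} (hρ : 0 < ρ)
    (hη : 0 ≤ η) (hδ : 0 ≤ δ) (t : Fin n → ℝ) :
    ∫⁻ ξ : Fin n → Ed d, ENNReal.ofReal ((∏ j, ‖ξ j‖ ^ η) * ‖jointCharFun P X t ξ‖) ≤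
      ∑' k : ℕ, ENNReal.ofReal (ρ ^ (-(η * n)) * (2 ^ k : ℝ) ^ (-δ)) *
        weightedIntegral P X (dyadicWeight ρ (η + δ) k) t := by
  have hm (k : ℕ) : Measurable fun ξ : Fin n → Ed d =>
      ENNReal.ofReal (dyadicWeight ρ (η + δ) k ξ * ‖jointCharFun P X t ξ‖) :=
    (measurable_dyadicWeight.mul (measurable_jointCharFun hmeas t).norm).ennreal_ofReal
  simp only [weightedIntegral]
  simp_rw [← lintegral_const_mul _ (hm _)]
  rw [← lintegral_tsum fun k => ((hm k).const_mul _).aemeasurable]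
  refine lintegral_mono fun ξ => ?_
  obtain ⟨k, hk⟩ := exists_prod_rpow_norm_le_dyadicWeight hρ hη hδ ξ
  refine le_trans ?_ (ENNReal.le_tsum k)
  rw [← ENNReal.ofReal_mul (by positivity)]
  refine ENNReal.ofReal_le_ofReal ?_
  rw [← mul_assoc, mul_assoc (ρ ^ _)]
  exact mul_le_mul_of_nonneg_right hk (norm_nonneg _)

end Shell

section Constants

variable {d m : ℕ}

theorem momentBound_le {C α θ e lam R : ℝ} (hC : 0 < C) (hlam : 0 < lam) (hR : 0 < R)
    (hlamR : lam * R = (m + 1 : ℕ)) :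
    momentBound d m C α θ e lam R ≤
      ENNReal.ofReal ((2 * C * Real.exp 1 * (1 + gapConst d α e)) ^ (m + 1) *
        ((m + 1 : ℕ) : ℝ) ^ (α * θ * ((m + 1 : ℕ) : ℝ)) * (lam ^ (α * d)) ^ m) := by
  have hg := gapConst_nonneg (d := d) (α := α) (e := e)
  set g := gapConst d α e
  set q : ℝ := ((m + 1 : ℕ) : ℝ) with hq
  have hq0 : 0 < q := by positivity
  have h1 : R⁻¹ * (lam ^ (α * d) * lam⁻¹ * g) = lam ^ (α * d) * g / q := by
    rw [← hlamR]
    field_simp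
  rw [momentBound, h1, hlamR, ← ENNReal.ofReal_natCast, ← ENNReal.ofReal_pow (by positivity),
    ← ENNReal.ofReal_mul (by positivity), ← ENNReal.ofReal_mul (by positivity),
    ← ENNReal.ofReal_mul (by positivity)]
  refine ENNReal.ofReal_le_ofReal ?_
  have h2 : Real.exp q = Real.exp 1 ^ (m + 1) := by rw [← Real.exp_nat_mul, mul_one]
  have h3 : ((m + 1).factorial : ℝ) ≤ 2 ^ (m + 1) * q ^ m := by
    have h4 : ((m + 1).factorial : ℝ) ≤ q ^ (m + 1) := by
      rw [hq]
      exact_mod_cast Nat.factorial_le_pow (m + 1)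
    have h5 : q ≤ 2 ^ (m + 1) := by
      rw [hq]
      exact_mod_cast Nat.lt_two_pow_self.le
    calc _ ≤ q ^ (m + 1) := h4
      _ = q * q ^ m := pow_succ' _ _
      _ ≤ _ := by gcongr
  have h6 : g ^ m ≤ (1 + g) ^ (m + 1) := by
    calc g ^ m ≤ (1 + g) ^ m := by gcongr; linarith
      _ ≤ _ := pow_le_pow_right₀ (by linarith) (by omega)
  rw [← hq, h2, div_pow, mul_pow (lam ^ (α * d)), mul_pow, mul_pow, mul_pow]
  calc _ ≤ C ^ (m + 1) * q ^ (α * θ * q) * Real.exp 1 ^ (m + 1) *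
        (2 ^ (m + 1) * q ^ m * ((lam ^ (α * d)) ^ m * (1 + g) ^ (m + 1) / q ^ m)) := by gcongr
    _ = _ := by
      field_simp

theorem volume_closedBall_mul_momentBound_le {C α θ e lam R v : ℝ} (hC : 0 < C) (hlam : 0 < lam)
    (hR : 0 < R) (hlamR : lam * R = (m + 1 : ℕ)) (hv : 0 ≤ v)
    (hvol : volume (Metric.ball (0 : Ed d) 1) = ENNReal.ofReal v) {p n : ℕ} (hp : 1 ≤ p)
    (hm : 2 * p * n = m + 1) (k : ℕ) :
    volume (Metric.closedBall (0 : Ed d) (p * (2 ^ (k + 1) / lam ^ (-α)))) *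
        momentBound d m C α θ e lam R ≤
      ENNReal.ofReal ((2 ^ k : ℝ) ^ ((d : ℝ) / (2 * p)) *
        ((2 * C * Real.exp 1 * (1 + gapConst d α e) * (1 + (2 * p) ^ d * v)) ^ n *
          ((m + 1 : ℕ) : ℝ) ^ (α * θ * n) * lam ^ (α * d * n))) ^ (2 * p) := by
  have hmb := momentBound_le (d := d) (α := α) (θ := θ) (e := e) hC hlam hR hlamR
  have hg := gapConst_nonneg (d := d) (α := α) (e := e)
  set g := gapConst d α e
  set D := 2 * C * Real.exp 1 * (1 + g) with hD
  have hD0 : 0 < D := by positivity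
  have hp0 : (p : ℝ) ≠ 0 := by positivity
  have hqn : ((m + 1 : ℕ) : ℝ) = 2 * p * n := by
    rw [← hm]
    push_cast
    ring
  refine (mul_le_mul_right hmb _).trans ?_
  rw [Measure.addHaar_closedBall _ _ (by positivity), hvol, finrank_euclideanSpace_fin,
    ← ENNReal.ofReal_mul (by positivity), ← ENNReal.ofReal_mul (by positivity),
    ← ENNReal.ofReal_pow (by positivity)]
  refine ENNReal.ofReal_le_ofReal ?_
  have e1 : ((2 ^ k : ℝ) ^ ((d : ℝ) / (2 * p))) ^ (2 * p) = (2 ^ k) ^ d := by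
    rw [← Real.rpow_natCast, ← Real.rpow_mul (by positivity), ← Real.rpow_natCast _ d]
    congr 1
    push_cast
    field_simp
  have e2 : (((m + 1 : ℕ) : ℝ) ^ (α * θ * n)) ^ (2 * p) =
      ((m + 1 : ℕ) : ℝ) ^ (α * θ * ((m + 1 : ℕ) : ℝ)) := by
    rw [← Real.rpow_natCast, ← Real.rpow_mul (by positivity), hqn]
    congr 1
    push_cast
    ring
  have e3 : (lam ^ (α * d * n)) ^ (2 * p) = lam ^ (α * d) * (lam ^ (α * d)) ^ m := by
    rw [← pow_succ', ← hm, ← Real.rpow_natCast, ← Real.rpow_mul hlam.le, ← Real.rpow_natCast,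
      ← Real.rpow_mul hlam.le]
    congr 1
    push_cast
    ring
  have e4 : (p * (2 ^ (k + 1) / lam ^ (-α))) ^ d = (2 * p) ^ d * (2 ^ k) ^ d * lam ^ (α * d) := by
    rw [Real.rpow_neg hlam.le, div_inv_eq_mul, Real.rpow_mul hlam.le, Real.rpow_natCast,
      ← mul_pow, ← mul_pow]
    congr 1
    ring
  have e5 : (2 * p : ℝ) ^ d * v ≤ (1 + (2 * p) ^ d * v) ^ (m + 1) := by
    have h0 : 0 ≤ (2 * p : ℝ) ^ d * v := by positivity
    calc _ ≤ 1 + (2 * p : ℝ) ^ d * v := by linarith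
      _ ≤ _ := le_self_pow₀ (by linarith) (by omega)
  have e6 : ((D * (1 + (2 * p) ^ d * v)) ^ n) ^ (2 * p) =
      D ^ (m + 1) * (1 + (2 * p) ^ d * v) ^ (m + 1) := by
    rw [← pow_mul, mul_comm n, hm, mul_pow]
  rw [mul_pow ((2 ^ k : ℝ) ^ ((d : ℝ) / (2 * p))), mul_pow _ (lam ^ (α * d * n)),
    mul_pow _ (((m + 1 : ℕ) : ℝ) ^ (α * θ * n)), e1, e2, e3, e4, e6]
  calc _ = (2 ^ k : ℝ) ^ d * (D ^ (m + 1) * ((2 * p : ℝ) ^ d * v) *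
        ((m + 1 : ℕ) : ℝ) ^ (α * θ * ((m + 1 : ℕ) : ℝ)) *
        (lam ^ (α * d) * (lam ^ (α * d)) ^ m)) := by ring
    _ ≤ _ := by gcongr

theorem tsum_ofReal_two_pow_rpow_neg {s : ℝ} (hs : 0 < s) :
    ∑' k : ℕ, ENNReal.ofReal ((2 ^ k : ℝ) ^ (-s)) = ENNReal.ofReal (1 - 2 ^ (-s))⁻¹ := by
  have h1 (k : ℕ) : (2 ^ k : ℝ) ^ (-s) = ((2 : ℝ) ^ (-s)) ^ k := by
    rw [← Real.rpow_natCast, ← Real.rpow_mul two_pos.le, ← Real.rpow_natCast,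
      ← Real.rpow_mul two_pos.le, mul_comm]
  have h2 : (2 : ℝ) ^ (-s) < 1 := Real.rpow_lt_one_of_one_lt_of_neg one_lt_two (by linarith)
  simp_rw [h1]
  rw [← ENNReal.ofReal_tsum_of_nonneg (fun k => by positivity)
    (summable_geometric_of_lt_one (by positivity) h2), tsum_geometric_of_lt_one (by positivity) h2]

end Constants

section Assembly

theorem setLIntegral_pi_Icc_eq {n : ℕ} {u U : ℝ} (hu : u < U) (F : (Fin n → ℝ) → ENNReal) :
    ∫⁻ t in univ.pi (fun _ : Fin n => Icc u U), F t =
      ENNReal.ofReal ((U - u) ^ n) * ∫⁻ t, F t ∂(Measure.pi fun _ => unif u U) := by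
  have hR : 0 < U - u := sub_pos.2 hu
  rw [pi_unif, lintegral_smul_measure, smul_eq_mul, Fintype.card_fin, ← mul_assoc,
    ← ENNReal.ofReal_pow (by positivity), ← ENNReal.ofReal_mul (by positivity), ← mul_pow,
    mul_inv_cancel₀ hR.ne', one_pow, ENNReal.ofReal_one, one_mul]

theorem exists_exponents {d : ℕ} {α η : ℝ} (hα : 0 < α)
    (hη' : η < min 1 ((1 - α * d) / (2 * α))) :
    ∃ (δ : ℝ) (p : ℕ), 0 < δ ∧ η + δ ≤ 1 ∧ α * (d + 2 * (η + δ)) < 1 ∧ 1 ≤ p ∧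
      (d : ℝ) / (2 * p) < δ := by
  obtain ⟨h1, h2⟩ := lt_min_iff.1 hη'
  rw [lt_div_iff₀ (by positivity)] at h2
  set δ := min (1 - η) ((1 - α * (d + 2 * η)) / (4 * α)) with hδ
  have hδ0 : 0 < δ := lt_min (by linarith) (div_pos (by linarith) (by positivity))
  have hδ1 : δ ≤ 1 - η := min_le_left _ _
  have hδ2 : δ ≤ (1 - α * (d + 2 * η)) / (4 * α) := min_le_right _ _
  rw [le_div_iff₀ (by positivity)] at hδ2
  obtain ⟨p, hp⟩ := exists_nat_gt ((d : ℝ) / (2 * δ))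
  have hp0 : (0 : ℝ) < p := lt_of_le_of_lt (by positivity) hp
  refine ⟨δ, p, hδ0, by linarith, by linarith, by exact_mod_cast hp0, ?_⟩
  rw [div_lt_iff₀ (by positivity)] at hp ⊢
  linarith

theorem rescaled_constant_le {n p : ℕ} {S D α θ η R : ℝ} {d : ℕ} (hS : 1 ≤ S) (hD : 0 ≤ D)
    (hR : 0 < R) (hp : 1 ≤ p) (hn : 1 ≤ n) :
    R ^ n * (((2 * p * n / R) ^ (-α)) ^ (-(η * n)) * (D ^ n * (2 * p * n : ℝ) ^ (α * θ * n) *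
        (2 * p * n / R) ^ (α * d * n)) * S) ≤
      (S * D * (2 * p : ℝ) ^ (α * (d + η + θ))) ^ n * (n : ℝ) ^ ((n : ℝ) * α * (d + η + θ)) *
        R ^ ((1 - α * (d + η)) * n) := by
  have hn0 : (0 : ℝ) < n := by positivity
  have hp0 : (0 : ℝ) < p := by positivity
  have hq0 : (0 : ℝ) < 2 * p * n := by positivity
  have e1 : ((2 * p * n / R) ^ (-α)) ^ (-(η * n)) = (2 * p * n / R) ^ (α * η * n) := by
    rw [← Real.rpow_mul (by positivity)]
    congr 1
    ring
  have e2 : (2 * p * n / R) ^ (α * η * n) * (2 * p * n / R) ^ (α * d * n) =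
      (2 * p * n) ^ (α * (d + η) * n) * R ^ (-(α * (d + η) * n)) := by
    rw [← Real.rpow_add (by positivity), Real.rpow_neg hR.le, ← div_eq_mul_inv,
      ← Real.div_rpow hq0.le hR.le]
    congr 1
    ring
  have e3 : (2 * p * n : ℝ) ^ (α * θ * n) * (2 * p * n) ^ (α * (d + η) * n) =
      ((2 * p : ℝ) ^ (α * (d + η + θ))) ^ n * (n : ℝ) ^ ((n : ℝ) * α * (d + η + θ)) := by
    rw [← Real.rpow_add hq0, ← Real.rpow_natCast ((2 * p : ℝ) ^ _), ← Real.rpow_mul (by positivity),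
      Real.mul_rpow (by positivity) hn0.le]
    congr 2 <;> ring
  have e4 : R ^ n * R ^ (-(α * (d + η) * n)) = R ^ ((1 - α * (d + η)) * n) := by
    rw [← Real.rpow_natCast, ← Real.rpow_add hR]
    congr 1
    ring
  calc _ = D ^ n * S * ((2 * p * n : ℝ) ^ (α * θ * n) *
        ((2 * p * n / R) ^ (α * η * n) * (2 * p * n / R) ^ (α * d * n))) * R ^ n := by
        rw [e1]
        ring
    _ = D ^ n * S * (((2 * p : ℝ) ^ (α * (d + η + θ))) ^ n *
        (n : ℝ) ^ ((n : ℝ) * α * (d + η + θ))) * R ^ ((1 - α * (d + η)) * n) := by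
        rw [e2, ← e3, ← e4]
        ring
    _ ≤ D ^ n * S ^ n * (((2 * p : ℝ) ^ (α * (d + η + θ))) ^ n *
        (n : ℝ) ^ ((n : ℝ) * α * (d + η + θ))) * R ^ ((1 - α * (d + η)) * n) := by
        gcongr
        exact le_self_pow₀ hS (by omega)
    _ = _ := by
        rw [mul_pow, mul_pow]
        ring

end Assembly

/-- Proposition prop:int_fourier: under (A1), for `0 ≤ η < min(1,(1-αd)/(2α))`
there is a constant `C > 0` depending only on `α, d, η` (and the constants in (A1)) such
that for all `n ≥ 1` and all `0 < u < U ≤ T`, the Fourier-type integral is bounded by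
`C^n n^{nα(d+η+θ)} (U-u)^{(1-α(d+η))n}`. -/
theorem fourier_integral_bound
    {Ω : Type*} [MeasurableSpace Ω] (P : Measure Ω) [IsProbabilityMeasure P]
    {d : ℕ} (hd : 0 < d) (T : ℝ) (hT : 0 < T)
    (X : ℝ → Ω → Ed d) (hmeas : ∀ t : ℝ, Measurable (X t))
    (α θ : ℝ) (hα : 0 < α) (hαd : α < 1 / d) (hθ : 0 ≤ θ)
    (hA1 : CondA1 P X T α θ)
    (η : ℝ) (hη : 0 ≤ η) (hη' : η < min 1 ((1 - α * d) / (2 * α))) :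
    ∃ C : ℝ, 0 < C ∧ ∀ n : ℕ, 1 ≤ n → ∀ u U : ℝ, 0 < u → u < U → U ≤ T →
      ∫⁻ tt in Set.univ.pi (fun _ : Fin n => Icc u U),
          ∫⁻ ξ : Fin n → Ed d,
            ENNReal.ofReal ((∏ j, ‖ξ j‖ ^ η) *
              ‖∫ ω, Complex.exp (Complex.I * Complex.ofReal
                  (∑ j, ⟪ξ j, X (tt j) ω⟫)) ∂P‖) ≤
        ENNReal.ofReal (C ^ n * (n : ℝ) ^ ((n : ℝ) * α * (d + η + θ)) *
          (U - u) ^ ((1 - α * (d + η)) * n)) := by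
  obtain ⟨C, hC0, hC⟩ := hA1
  obtain ⟨δ, p, hδ, hδ1, hδ2, hp, hpδ⟩ := exists_exponents hα hη'
  have hp0 : (0 : ℝ) < p := by exact_mod_cast hp
  have hg := gapConst_nonneg (d := d) (α := α) (e := η + δ)
  have hvt : volume (Metric.ball (0 : Ed d) 1) ≠ ⊤ := measure_ball_lt_top.ne
  set v := (volume (Metric.ball (0 : Ed d) 1)).toReal with hv
  set D := 2 * C * Real.exp 1 * (1 + gapConst d α (η + δ)) * (1 + (2 * p) ^ d * v) with hD
  have hD0 : 0 < D := by positivity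
  set s := δ - d / (2 * p) with hs
  have hs0 : 0 < s := sub_pos.2 hpδ
  have hS0 : (2 : ℝ) ^ (-s) < 1 := Real.rpow_lt_one_of_one_lt_of_neg one_lt_two (by linarith)
  have hS1 : 1 ≤ (1 - (2 : ℝ) ^ (-s))⁻¹ :=
    (one_le_inv₀ (by linarith)).2 (by linarith [Real.rpow_pos_of_pos two_pos (-s)])
  refine ⟨(1 - 2 ^ (-s))⁻¹ * D * (2 * p : ℝ) ^ (α * (d + η + θ)), by positivity,
    fun n hn u U hu0 hu hUT => ?_⟩
  have hn0 : (0 : ℝ) < n := by exact_mod_cast hn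
  have hR : 0 < U - u := sub_pos.2 hu
  obtain ⟨m, hm⟩ : ∃ m, 2 * p * n = m + 1 :=
    Nat.exists_eq_succ_of_ne_zero (by positivity)
  have hqn : ((m + 1 : ℕ) : ℝ) = 2 * p * n := by
    rw [← hm]
    push_cast
    ring
  set lam := 2 * p * n / (U - u) with hlam
  have hlam0 : 0 < lam := by positivity
  have hlamR : lam * (U - u) = (m + 1 : ℕ) := by
    rw [hqn, hlam, div_mul_cancel₀ _ hR.ne']
  set Q := D ^ n * (2 * p * n : ℝ) ^ (α * θ * n) * lam ^ (α * d * n) with hQ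
  have hshell (k : ℕ) : upperIntegral (Measure.pi fun _ => unif u U)
      (weightedIntegral P X (dyadicWeight (n := n) (lam ^ (-α)) (η + δ) k)) ≤
      ENNReal.ofReal ((2 ^ k : ℝ) ^ ((d : ℝ) / (2 * p)) * Q) := by
    have h1 := (upperIntegral_weightedIntegral_pow_le hmeas hC0 hC hlam0 hα (by positivity) hδ1
      hδ2 hu0 hu hUT hp hn hm k).trans (volume_closedBall_mul_momentBound_le (v := v) hC0 hlam0
        hR hlamR ENNReal.toReal_nonneg (ENNReal.ofReal_toReal hvt).symm hp hm k)
    rw [hqn] at h1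
    exact (ENNReal.pow_le_pow_left_iff (by omega)).1 h1
  rw [setLIntegral_pi_Icc_eq hu]
  calc _ ≤ ENNReal.ofReal ((U - u) ^ n) * ∑' k : ℕ, ENNReal.ofReal
        ((lam ^ (-α)) ^ (-(η * n)) * (2 ^ k : ℝ) ^ (-δ)) *
          upperIntegral (Measure.pi fun _ => unif u U)
            (weightedIntegral P X (dyadicWeight (n := n) (lam ^ (-α)) (η + δ) k)) := by
        refine mul_le_mul_right (lintegral_tsum_le_tsum_upperIntegral (Eventually.of_forall
          fun t => ?_)) _
        exact lintegral_prod_rpow_norm_le_tsum hmeas (by positivity) hη hδ.le t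
    _ ≤ ENNReal.ofReal ((U - u) ^ n) * ∑' k : ℕ, ENNReal.ofReal
        ((lam ^ (-α)) ^ (-(η * n)) * Q) * ENNReal.ofReal ((2 ^ k : ℝ) ^ (-s)) := by
        refine mul_le_mul_right (ENNReal.tsum_le_tsum fun k => ?_) _
        refine (mul_le_mul_right (hshell k) _).trans_eq ?_
        rw [← ENNReal.ofReal_mul (by positivity), ← ENNReal.ofReal_mul (by positivity)]
        congr 1
        have : (2 ^ k : ℝ) ^ (-s) = (2 ^ k : ℝ) ^ (-δ) * (2 ^ k : ℝ) ^ ((d : ℝ) / (2 * p)) := by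
          rw [← Real.rpow_add (by positivity), hs]
          congr 1
          ring
        rw [this]
        ring
    _ = ENNReal.ofReal ((U - u) ^ n * ((lam ^ (-α)) ^ (-(η * n)) * Q * (1 - 2 ^ (-s))⁻¹)) := by
        rw [ENNReal.tsum_mul_left, tsum_ofReal_two_pow_rpow_neg hs0,
          ← ENNReal.ofReal_mul (by positivity), ← ENNReal.ofReal_mul (by positivity)]
    _ ≤ _ := ENNReal.ofReal_le_ofReal (rescaled_constant_le hS1 hD0.le hR hp hn)
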